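/- arXiv:2401.04314 — 4 statements merged into one kernel-verified Lean document; each statement's English description precedes it below -/
import Mathlib

section
/- Let A be a commutative ring and n a natural number. Every element of the symplectic group Sp_{2n}(A((t))) (matrices M of size 2n over A((t)) with M * J * Mᵀ = J for the standard symplectic form J) factors as Sp_{2n}(A((t))) = Sp_{2n}(A[t, t⁻¹]) · Sp_{2n}(A⟦t⟧): for every g ∈ Sp_{2n}(A((t))) there exist a ∈ Sp_{2n}(A[t, t⁻¹]) and b ∈ Sp_{2n}(A⟦t⟧) whose images under the canonical ring homomorphisms A[t, t⁻¹] → A((t)) and A⟦t⟧ → A((t)) multiply to g. -/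
/-- The canonical ring homomorphism from Laurent polynomials `A[t, t⁻¹]` to Laurent series
`A((t))` (the localization of `A⟦t⟧` away from `t`), sending `t` to the image of `t`. -/
noncomputable def laurentInclusion (A : Type*) [CommRing A] :
    LaurentPolynomial A →+* Localization.Away (PowerSeries.X : PowerSeries A) :=
  haveI := LaurentPolynomial.isLocalization (R := A)
  IsLocalization.Away.lift (P := Localization.Away (PowerSeries.X : PowerSeries A))
    (Polynomial.X : Polynomial A)
    (g := (algebraMap (PowerSeries A) _).comp (Polynomial.coeToPowerSeries.ringHom))
    (by
      rw [RingHom.comp_apply]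
      simp only [Polynomial.coeToPowerSeries.ringHom_apply, Polynomial.coe_X]
      exact IsLocalization.Away.algebraMap_isUnit _)

namespace SymplecticGroup

open Matrix

variable {l R S T : Type*} [DecidableEq l] [Fintype l] [CommRing R] [CommRing S] [CommRing T]

/-- The homomorphism of symplectic groups induced by a ring homomorphism. -/
def map (φ : R →+* S) : symplecticGroup l R →* symplecticGroup l S where
  toFun a := ⟨φ.mapMatrix a, map_mem a.2 φ⟩
  map_one' := Subtype.ext (map_one φ.mapMatrix)
  map_mul' a b := Subtype.ext (map_mul φ.mapMatrix a.1 b.1)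

@[simp]
theorem coe_map (φ : R →+* S) (a : symplecticGroup l R) :
    (map φ a : Matrix (l ⊕ l) (l ⊕ l) S) = φ.mapMatrix a.1 := rfl

theorem map_apply (φ : R →+* S) (a : symplecticGroup l R) (i j : l ⊕ l) :
    (map φ a).1 i j = φ (a.1 i j) := rfl

theorem map_map (φ : R →+* S) (ψ : S →+* T) (a : symplecticGroup l R) :
    map ψ (map φ a) = map (ψ.comp φ) a := rfl

theorem map_map_comm {S' : Type*} [CommRing S'] {φ : R →+* S} {ψ : S →+* T} {φ' : R →+* S'}
    {ψ' : S' →+* T} (h : ψ.comp φ = ψ'.comp φ') (a : symplecticGroup l R) :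
    map ψ (map φ a) = map ψ' (map φ' a) := by
  rw [map_map, map_map, h]

theorem map_injective {φ : R →+* S} (hφ : Function.Injective φ) :
    Function.Injective (map (l := l) φ) := fun _ _ h ↦
  Subtype.ext <| Matrix.ext fun i j ↦ hφ congr($(h).1 i j)

/-- A matrix that becomes symplectic along two jointly injective ring homomorphisms is
symplectic. -/
theorem mem_of_map_mem {φ : R →+* S} {ψ : R →+* T} (h : ∀ x, φ x = 0 → ψ x = 0 → x = 0)
    {M : Matrix (l ⊕ l) (l ⊕ l) R} (hφ : φ.mapMatrix M ∈ symplecticGroup l S)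
    (hψ : ψ.mapMatrix M ∈ symplecticGroup l T) : M ∈ symplecticGroup l R := by
  rw [mem_iff, ← map_J l φ, RingHom.mapMatrix_apply, ← transpose_map, ← Matrix.map_mul,
    ← Matrix.map_mul] at hφ
  rw [mem_iff, ← map_J l ψ, RingHom.mapMatrix_apply, ← transpose_map, ← Matrix.map_mul,
    ← Matrix.map_mul] at hψ
  rw [mem_iff]
  ext p q
  exact sub_eq_zero.1 <| h _ ((map_sub φ _ _).trans (sub_eq_zero.2 congr($hφ p q)))
    ((map_sub ψ _ _).trans (sub_eq_zero.2 congr($hψ p q)))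

theorem exists_map_eq {φ : R →+* S} (hφ : Function.Injective φ) {a : symplecticGroup l S}
    (ha : ∀ i j, a.1 i j ∈ φ.range) : ∃ b, map φ b = a := by
  choose b hb using ha
  have h : φ.mapMatrix (Matrix.of b) = a.1 := Matrix.ext fun i j ↦ hb i j
  exact ⟨⟨Matrix.of b, mem_of_map_mem (φ := φ) (ψ := φ)
    (fun x h _ ↦ (map_eq_zero_iff φ hφ).1 h) (h ▸ a.2) (h ▸ a.2)⟩, Subtype.ext h⟩

section Generators

variable {X : Matrix l l R}

theorem upper_mem (hX : X.IsSymm) : fromBlocks 1 X 0 1 ∈ symplecticGroup l R := by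
  simp [fromBlocks_mem_iff, hX.eq]

theorem lower_mem (hX : X.IsSymm) : fromBlocks 1 0 X 1 ∈ symplecticGroup l R := by
  simp [fromBlocks_mem_iff, hX.eq]

theorem levi_mem {Y : Matrix l l R} (h : Xᵀ * Y = 1) :
    fromBlocks X 0 0 Y ∈ symplecticGroup l R := by
  simp [fromBlocks_mem_iff, h]

/-- The block decomposition of a symplectic matrix with invertible upper-left block. -/
theorem eq_lower_mul_levi_mul_upper {A B C D : Matrix l l R} (hA : IsUnit A.det)
    (h : fromBlocks A B C D ∈ symplecticGroup l R) :
    (C * A⁻¹).IsSymm ∧ (A⁻¹ * B).IsSymm ∧ fromBlocks A B C D =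
      fromBlocks 1 0 (C * A⁻¹) 1 * fromBlocks A 0 0 A⁻¹ᵀ * fromBlocks 1 (A⁻¹ * B) 0 1 := by
  have hAt : IsUnit Aᵀ.det := by rwa [det_transpose]
  obtain ⟨h1, -, h3⟩ := fromBlocks_mem_iff.1 h
  obtain ⟨h4, -, -⟩ := fromBlocks_mem_iff.1
    (fromBlocks_transpose A B C D ▸ transpose_mem h)
  rw [transpose_transpose, transpose_transpose] at h4
  have s1 : (C * A⁻¹).IsSymm := by
    have : Aᵀ * (C * A⁻¹)  = Cᵀ := by rw [← mul_assoc, h1, mul_nonsing_inv_cancel_right _ _ hA]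
    rw [IsSymm, transpose_mul, ← this, ← mul_assoc, transpose_nonsing_inv,
      nonsing_inv_mul _ hAt, one_mul]
  have s2 : (A⁻¹ * B).IsSymm := by
    have : A⁻¹ * B * Aᵀ = Bᵀ := by
      rw [mul_assoc, ← h4, nonsing_inv_mul_cancel_left _ _ hA]
    rw [IsSymm, transpose_mul, ← this, mul_assoc, transpose_nonsing_inv,
      mul_nonsing_inv _ hAt, mul_one]
  refine ⟨s1, s2, ?_⟩
  have hD : D = C * (A⁻¹ * B) + A⁻¹ᵀ := by
    have : Aᵀ * (D - C * (A⁻¹ * B)) = 1 := by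
      rw [mul_sub, ← mul_assoc, h1, mul_assoc, mul_nonsing_inv_cancel_left _ _ hA, h3]
    rw [transpose_nonsing_inv, inv_eq_right_inv this]
    abel
  rw [fromBlocks_multiply, fromBlocks_multiply]
  simp [mul_nonsing_inv_cancel_left _ _ hA, nonsing_inv_mul_cancel_right _ _ hA, ← hD]

end Generators

/-- Over a field, symplectic matrices are products of unipotent block matrices and
of transvections in the Levi factor. -/
theorem field_induction {K : Type*} [Field K] (P : Matrix (l ⊕ l) (l ⊕ l) K → Prop)
    (upper : ∀ X : Matrix l l K, X.IsSymm → P (fromBlocks 1 X 0 1))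
    (lower : ∀ X : Matrix l l K, X.IsSymm → P (fromBlocks 1 0 X 1))
    (transvec : ∀ t : TransvectionStruct l K,
      P (fromBlocks t.toMatrix 0 0 t.inv.toMatrixᵀ))
    (mul : ∀ a b, P a → P b → P (a * b)) {g : Matrix (l ⊕ l) (l ⊕ l) K}
    (hg : g ∈ symplecticGroup l K) : P g := by
  have levi (M : Matrix l l K) (hM : M.det ≠ 0) : P (fromBlocks M 0 0 M⁻¹ᵀ) := by
    refine diagonal_transvection_induction_of_det_ne_zero
      (fun M ↦ P (fromBlocks M 0 0 M⁻¹ᵀ)) M hM (fun d hd ↦ ?_) (fun t ↦ ?_)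
      fun A B hA hB h1 h2 ↦ ?_
    · have hd' : IsUnit (diagonal d).det := hd.isUnit
      have hs : (diagonal d)⁻¹.IsSymm := by
        rw [IsSymm, transpose_nonsing_inv, diagonal_transpose]
      have key : fromBlocks (diagonal d) 0 0 (diagonal d)⁻¹ᵀ =
          fromBlocks 1 (diagonal d) 0 1 * fromBlocks 1 0 (-(diagonal d)⁻¹) 1 *
            fromBlocks 1 (diagonal d) 0 1 *
          (fromBlocks 1 (-1) 0 1 * fromBlocks 1 0 1 1 * fromBlocks 1 (-1) 0 1) := by
        simp [fromBlocks_multiply, hs.eq, mul_nonsing_inv _ hd', nonsing_inv_mul _ hd']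
      rw [key]
      have u1 := upper _ (isSymm_diagonal d)
      have u2 := upper (-1) isSymm_one.neg
      exact mul _ _ (mul _ _ (mul _ _ u1 (lower _ hs.neg)) u1)
        (mul _ _ (mul _ _ u2 (lower _ isSymm_one)) u2)
    · rw [show t.toMatrix⁻¹ = t.inv.toMatrix from inv_eq_left_inv t.inv_mul]
      exact transvec t
    · have : fromBlocks (A * B) 0 0 (A * B)⁻¹ᵀ =
          fromBlocks A 0 0 A⁻¹ᵀ * fromBlocks B 0 0 B⁻¹ᵀ := by
        simp [fromBlocks_multiply, Matrix.mul_inv_rev]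
      rw [this]
      exact mul _ _ h1 h2
  obtain ⟨A, B, C, D, rfl⟩ : ∃ A B C D, g = fromBlocks A B C D :=
    ⟨_, _, _, _, (fromBlocks_toBlocks g).symm⟩
  suffices ∃ X : Matrix l l K, X.IsSymm ∧ (A + X * C).det ≠ 0 by
    obtain ⟨X, hX, hdet⟩ := this
    have hmul : fromBlocks 1 X 0 1 * fromBlocks A B C D =
        fromBlocks (A + X * C) (B + X * D) C D := by simp [fromBlocks_multiply]
    have hmem := (symplecticGroup l K).mul_mem (upper_mem hX) hg
    rw [hmul] at hmem
    obtain ⟨s1, s2, h⟩ := eq_lower_mul_levi_mul_upper hdet.isUnit hmem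
    have : fromBlocks A B C D = fromBlocks 1 (-X) 0 1 *
        fromBlocks (A + X * C) (B + X * D) C D := by
      rw [← hmul, ← mul_assoc, fromBlocks_multiply]
      simp
    rw [this, h]
    exact mul _ _ (upper _ hX.neg)
      (mul _ _ (mul _ _ (lower _ s1) (levi _ hdet)) (upper _ s2))
  obtain ⟨L, L', d, hA⟩ := Pivot.exists_list_transvec_mul_diagonal_mul_list_transvec A
  set U := (L.map TransvectionStruct.toMatrix).prod
  set V := (L'.map TransvectionStruct.toMatrix).prod
  have hU : IsUnit U.det := by simp [U]
  have hV : IsUnit V.det := by simp [V]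
  have hUt : IsUnit Uᵀ.det := by rwa [det_transpose]
  set F := Uᵀ * C * V⁻¹ with hF
  have hC : C = Uᵀ⁻¹ * F * V := by
    rw [hF, mul_assoc, nonsing_inv_mul_cancel_right _ _ hV,
      nonsing_inv_mul_cancel_left _ _ hUt]
  classical
  set e : l → K := fun i ↦ if d i = 0 then 1 else 0
  refine ⟨U * diagonal e * Uᵀ, by simp [IsSymm, mul_assoc], ?_⟩
  have hsum : A + U * diagonal e * Uᵀ * C = U * (diagonal d + diagonal e * F) * V := by
    rw [hA, hC]
    simp only [mul_add, add_mul, mul_assoc]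
    rw [mul_nonsing_inv_cancel_left _ _ hUt]
  have hsymm : diagonal d * F = Fᵀ * diagonal d := by
    have h1 := (fromBlocks_mem_iff.1 hg).1
    have h2 : Aᵀ * C = Vᵀ * (diagonal d * F) * V := by
      rw [hA, hC]
      simp only [transpose_mul, diagonal_transpose, mul_assoc]
      rw [mul_nonsing_inv_cancel_left _ _ hUt]
    have h3 : Cᵀ * A = Vᵀ * (Fᵀ * diagonal d) * V := by
      rw [← transpose_transpose A, ← transpose_mul, h2]
      simp [mul_assoc]
    rw [h2, h3] at h1
    have hVt : IsUnit Vᵀ.det := by rwa [det_transpose]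
    rw [← nonsing_inv_mul_cancel_left _ (diagonal d * F) hVt,
      ← mul_nonsing_inv_cancel_right _ (Vᵀ * (diagonal d * F)) hV, h1,
      mul_nonsing_inv_cancel_right _ _ hV, nonsing_inv_mul_cancel_left _ _ hVt]
  rw [hsum, det_mul, det_mul]
  refine mul_ne_zero (mul_ne_zero hU.ne_zero fun hdet ↦ ?_) hV.ne_zero
  obtain ⟨v, hv0, hv⟩ := exists_mulVec_eq_zero_iff.2 hdet
  have hvi (i : l) : d i * v i + e i * (F *ᵥ v) i = 0 := by
    simpa [add_mulVec, ← mulVec_mulVec, mulVec_diagonal] using congrFun hv i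
  have hd (i : l) : d i * v i = 0 := by
    by_cases h : d i = 0
    · simp [h]
    · simpa [e, h] using hvi i
  have hF0 : F *ᵥ v = 0 := by
    funext i
    by_cases h : d i = 0
    · simpa [e, h] using hvi i
    · have h1 : (diagonal d *ᵥ (F *ᵥ v)) i = (Fᵀ *ᵥ (diagonal d *ᵥ v)) i := by
        rw [mulVec_mulVec, hsymm, mulVec_mulVec]
      have h2 : diagonal d *ᵥ v = 0 := funext fun j ↦ by simp [mulVec_diagonal, hd]
      rw [h2, mulVec_zero, mulVec_diagonal] at h1
      simpa [h] using h1
  have hdv : diagonal d *ᵥ v = 0 := funext fun j ↦ by simp [mulVec_diagonal, hd]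
  set w := V⁻¹ *ᵥ v
  have hw : V *ᵥ w = v := by simp [w, mulVec_mulVec, mul_nonsing_inv _ hV]
  have hAw : A *ᵥ w = 0 := by
    rw [hA, ← mulVec_mulVec, hw, ← mulVec_mulVec, hdv, mulVec_zero]
  have hCw : C *ᵥ w = 0 := by
    rw [hC, ← mulVec_mulVec, hw, ← mulVec_mulVec, hF0, mulVec_zero]
  have hgw : fromBlocks A B C D *ᵥ Sum.elim w 0 = 0 := by
    simp [fromBlocks_mulVec, hAw, hCw]
  have h0 := eq_zero_of_mulVec_eq_zero (symplectic_det hg).ne_zero hgw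
  refine hv0 ?_
  rw [← hw, show w = 0 from funext fun i ↦ congrFun h0 (Sum.inl i), mulVec_zero]

end SymplecticGroup

namespace LaurentSeries

open HahnSeries

variable {R S : Type*} [CommRing R] [CommRing S]

/-- The coefficientwise ring homomorphism of Laurent series rings. -/
noncomputable def mapRingHom (φ : R →+* S) : LaurentSeries R →+* LaurentSeries S where
  toFun x := HahnSeries.map x φ
  map_one' := by ext n; by_cases h : n = 0 <;> simp [HahnSeries.coeff_one, h]
  map_mul' x y := HahnSeries.map_mul (φ : R →ₙ+* S)
  map_zero' := by ext n; simp
  map_add' x y := by ext n; simp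

@[simp]
theorem coeff_mapRingHom (φ : R →+* S) (x : LaurentSeries R) (n : ℤ) :
    (mapRingHom φ x).coeff n = φ (x.coeff n) := rfl

theorem mapRingHom_comp_mapRingHom {T : Type*} [CommRing T] (φ : R →+* S) (ψ : S →+* T) :
    (mapRingHom ψ).comp (mapRingHom φ) = mapRingHom (ψ.comp φ) := rfl

theorem coeff_ofPowerSeries (x : PowerSeries R) (n : ℤ) :
    (ofPowerSeries ℤ R x).coeff n = if n < 0 then 0 else PowerSeries.coeff n.natAbs x :=
  PowerSeries.coeff_coe x n

theorem coeff_ofPowerSeries_of_neg (x : PowerSeries R) {n : ℤ} (hn : n < 0) :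
    (ofPowerSeries ℤ R x).coeff n = 0 := by
  rw [coeff_ofPowerSeries, if_pos hn]

theorem mem_range_ofPowerSeries {x : LaurentSeries R} (hx : ∀ n < 0, x.coeff n = 0) :
    x ∈ (ofPowerSeries ℤ R).range := by
  refine ⟨PowerSeries.mk fun n ↦ x.coeff n, ?_⟩
  ext n
  rw [coeff_ofPowerSeries]
  split_ifs with h
  · exact (hx n h).symm
  · rw [PowerSeries.coeff_mk, Int.natAbs_of_nonneg (not_lt.1 h)]

theorem mapRingHom_comp_ofPowerSeries (φ : R →+* S) :
    (mapRingHom φ).comp (ofPowerSeries ℤ R) = (ofPowerSeries ℤ S).comp (PowerSeries.map φ) := by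
  ext x n
  simp only [RingHom.comp_apply, coeff_mapRingHom, coeff_ofPowerSeries]
  split_ifs <;> simp

theorem coeff_mul_eq_zero {x y : LaurentSeries R} {a b n : ℤ} (hx : ∀ n < a, x.coeff n = 0)
    (hy : ∀ n < b, y.coeff n = 0) (hn : n < a + b) : (x * y).coeff n = 0 := by
  rw [HahnSeries.coeff_mul]
  refine Finset.sum_eq_zero fun ij h ↦ ?_
  rw [Finset.mem_antidiagonal] at h
  by_cases h1 : ij.1 < a
  · rw [hx _ h1, zero_mul]
  · rw [hy _ (by lia), mul_zero]

theorem coeff_mul_eq_zero_of_gt {x y : LaurentSeries R} {a b n : ℤ} (hx : ∀ n > a, x.coeff n = 0)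
    (hy : ∀ n > b, y.coeff n = 0) (hn : n > a + b) : (x * y).coeff n = 0 := by
  rw [HahnSeries.coeff_mul]
  refine Finset.sum_eq_zero fun ij h ↦ ?_
  rw [Finset.mem_antidiagonal] at h
  by_cases h1 : ij.1 > a
  · rw [hx _ h1, zero_mul]
  · rw [hy _ (by lia), mul_zero]

theorem exists_coeff_eq_zero (x : LaurentSeries R) : ∃ a : ℤ, ∀ n < a, x.coeff n = 0 :=
  ⟨x.order, fun _ h ↦ coeff_eq_zero_of_lt_order h⟩

/-- The part of a Laurent series supported in a given set of exponents. -/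
noncomputable def restrict (s : Set ℤ) [DecidablePred (· ∈ s)] (x : LaurentSeries R) :
    LaurentSeries R where
  coeff n := if n ∈ s then x.coeff n else 0
  isPWO_support' := x.isPWO_support.mono fun n hn ↦ by
    rw [Function.mem_support] at hn
    exact fun h ↦ hn (by simp [h])

theorem coeff_restrict (s : Set ℤ) [DecidablePred (· ∈ s)] (x : LaurentSeries R) (n : ℤ) :
    (restrict s x).coeff n = if n ∈ s then x.coeff n else 0 := rfl

end LaurentSeries

namespace LaurentPolynomial

open HahnSeries LaurentSeries

variable {R S : Type*} [CommRing R] [CommRing S]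

/-- The inclusion of Laurent polynomials into Laurent series. -/
noncomputable def toLaurentSeries (R : Type*) [CommRing R] :
    LaurentPolynomial R →+* LaurentSeries R :=
  (IsLocalization.algEquiv (Submonoid.powers (PowerSeries.X : PowerSeries R))
    (Localization.Away (PowerSeries.X : PowerSeries R))
    (LaurentSeries R)).toRingEquiv.toRingHom.comp (laurentInclusion R)

theorem toLaurentSeries_toLaurent (p : Polynomial R) :
    toLaurentSeries R (Polynomial.toLaurent p) = ofPowerSeries ℤ R p := by
  have h : laurentInclusion R (Polynomial.toLaurent p) =
      algebraMap (PowerSeries R) _ (p : PowerSeries R) := by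
    rw [← algebraMap_eq_toLaurent]
    exact IsLocalization.Away.lift_eq _ _ p
  rw [toLaurentSeries, RingHom.comp_apply, h]
  exact AlgEquiv.commutes (IsLocalization.algEquiv
    (Submonoid.powers (PowerSeries.X : PowerSeries R))
    (Localization.Away (PowerSeries.X : PowerSeries R)) (LaurentSeries R)) _

theorem toLaurentSeries_C_mul_T (a : R) (n : ℤ) :
    toLaurentSeries R (C a * T n) = single n a := by
  have hT (m : ℕ) : toLaurentSeries R (T m) = single (m : ℤ) 1 := by
    rw [← Polynomial.toLaurent_X_pow, toLaurentSeries_toLaurent]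
    simp
  have hC : toLaurentSeries R (C a) = single 0 a := by
    rw [← Polynomial.toLaurent_C, toLaurentSeries_toLaurent]
    simp
  have hT' : toLaurentSeries R (T n) = single n 1 := by
    obtain ⟨m, rfl | rfl⟩ := n.eq_nat_or_neg
    · exact hT m
    · have h1 : toLaurentSeries R (T (-m)) * single (m : ℤ) 1 = 1 := by
        rw [← hT, ← map_mul, ← T_add]; simp
      have h2 : (single (m : ℤ) 1 : LaurentSeries R) * single (-m : ℤ) 1 = 1 := by simp
      rw [← mul_one (toLaurentSeries R (T (-m))), ← h2, ← mul_assoc, h1, one_mul]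
  rw [map_mul, hC, hT']
  simp

@[simp]
theorem coeff_toLaurentSeries (p : LaurentPolynomial R) (n : ℤ) :
    (toLaurentSeries R p).coeff n = p.coeff n := by
  induction p using LaurentPolynomial.induction_on' with
  | add p q hp hq => simp [hp, hq]
  | C_mul_T m a =>
    rw [toLaurentSeries_C_mul_T, ← single_eq_C_mul_T, coeff_single, AddMonoidAlgebra.coeff_single,
      Finsupp.single_apply]
    by_cases h : n = m
    · simp [h]
    · simp [h, Ne.symm h]

theorem toLaurentSeries_injective : Function.Injective (toLaurentSeries R) := fun p q h ↦
  LaurentPolynomial.ext fun n ↦ by simpa using congr(($h).coeff n)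

theorem mem_range_toLaurentSeries {x : LaurentSeries R} {a : ℤ} (hx : ∀ n > a, x.coeff n = 0) :
    x ∈ (toLaurentSeries R).range := by
  obtain ⟨b, hb⟩ := exists_coeff_eq_zero x
  refine ⟨.ofCoeff (Finsupp.onFinset (Finset.Icc b a) x.coeff fun n hn ↦ ?_), ?_⟩
  · rw [Finset.mem_Icc]
    exact ⟨not_lt.1 fun h ↦ hn (hb n h), not_lt.1 fun h ↦ hn (hx n h)⟩
  · ext n
    simp

/-- The coefficientwise ring homomorphism of Laurent polynomial rings. -/
noncomputable def mapRingHom (φ : R →+* S) : LaurentPolynomial R →+* LaurentPolynomial S :=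
  AddMonoidAlgebra.mapRingHom ℤ φ

@[simp]
theorem coeff_mapRingHom (φ : R →+* S) (p : LaurentPolynomial R) (n : ℤ) :
    (mapRingHom φ p).coeff n = φ (p.coeff n) := by
  simp [mapRingHom]

theorem mapRingHom_comp_toLaurentSeries (φ : R →+* S) :
    (LaurentSeries.mapRingHom φ).comp (toLaurentSeries R) =
      (toLaurentSeries S).comp (mapRingHom φ) := by
  apply RingHom.ext
  intro p
  ext n
  simp

theorem mapRingHom_comp_toLaurent (φ : R →+* S) :
    (mapRingHom φ).comp Polynomial.toLaurent =
      Polynomial.toLaurent.comp (Polynomial.mapRingHom φ) := by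
  apply RingHom.ext
  intro p
  apply toLaurentSeries_injective
  have h := congr($(mapRingHom_comp_toLaurentSeries φ) (Polynomial.toLaurent p))
  simp only [RingHom.comp_apply] at h ⊢
  rw [← h, toLaurentSeries_toLaurent, toLaurentSeries_toLaurent]
  ext n
  rw [LaurentSeries.coeff_mapRingHom, coeff_ofPowerSeries, coeff_ofPowerSeries]
  split_ifs <;> simp

/-- Evaluation of Laurent polynomials at `1`. -/
noncomputable def evalOne (R : Type*) [CommRing R] : LaurentPolynomial R →+* R :=
  eval₂ (RingHom.id R) 1

theorem evalOne_comp_mapRingHom (φ : R →+* S) :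
    (evalOne S).comp (mapRingHom φ) = φ.comp (evalOne R) := by
  apply RingHom.ext
  intro p
  induction p using LaurentPolynomial.induction_on' with
  | add p q hp hq => simp only [map_add, hp, hq]
  | C_mul_T m a =>
    rw [← single_eq_C_mul_T, RingHom.comp_apply, RingHom.comp_apply, mapRingHom,
      AddMonoidAlgebra.mapRingHom_single, single_eq_C_mul_T, single_eq_C_mul_T]
    simp [evalOne]

theorem evalOne_toLaurent (p : Polynomial R) :
    evalOne R (Polynomial.toLaurent p) = p.eval 1 := by
  simp [evalOne]

theorem evalOne_comp_C : (evalOne R).comp (C : R →+* LaurentPolynomial R) = RingHom.id R := by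
  ext; simp [evalOne]

theorem mem_range_toLaurent {p : LaurentPolynomial R} (hp : ∀ n < 0, p.coeff n = 0) :
    p ∈ (Polynomial.toLaurent (R := R)).range := by
  obtain ⟨x, hx⟩ := mem_range_ofPowerSeries (x := toLaurentSeries R p) (by simpa using hp)
  refine ⟨trunc p, toLaurentSeries_injective ?_⟩
  rw [toLaurentSeries_toLaurent]
  ext n
  rw [coeff_ofPowerSeries]
  split_ifs with h
  · simpa using (hp n h).symm
  · obtain ⟨m, rfl⟩ := Int.eq_ofNat_of_zero_le (not_lt.1 h)
    simp [trunc, Polynomial.coeff_ofFinsupp]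

end LaurentPolynomial

namespace LaurentSeries

open Matrix

variable {ι κ μ R : Type*} [Fintype κ] [CommRing R]

theorem coeff_matrix_mul_eq_zero {M : Matrix ι κ (LaurentSeries R)}
    {N : Matrix κ μ (LaurentSeries R)} {a b : ℤ} (hM : ∀ i j, ∀ n < a, (M i j).coeff n = 0)
    (hN : ∀ i j, ∀ n < b, (N i j).coeff n = 0) (i j) {n : ℤ} (hn : n < a + b) :
    ((M * N) i j).coeff n = 0 := by
  rw [mul_apply, HahnSeries.coeff_sum]
  exact Finset.sum_eq_zero fun k _ ↦ coeff_mul_eq_zero (hM i k) (hN k j) hn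

theorem coeff_matrix_mul_eq_zero_of_gt {M : Matrix ι κ (LaurentSeries R)}
    {N : Matrix κ μ (LaurentSeries R)} {a b : ℤ} (hM : ∀ i j, ∀ n > a, (M i j).coeff n = 0)
    (hN : ∀ i j, ∀ n > b, (N i j).coeff n = 0) (i j) {n : ℤ} (hn : n > a + b) :
    ((M * N) i j).coeff n = 0 := by
  rw [mul_apply, HahnSeries.coeff_sum]
  exact Finset.sum_eq_zero fun k _ ↦ coeff_mul_eq_zero_of_gt (hM i k) (hN k j) hn

theorem exists_coeff_matrix_eq_zero [Finite ι] (M : Matrix ι κ (LaurentSeries R)) :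
    ∃ a : ℤ, ∀ i j, ∀ n < a, (M i j).coeff n = 0 := by
  choose a ha using fun p : ι × κ ↦ exists_coeff_eq_zero (M p.1 p.2)
  obtain ⟨b, hb⟩ := (Set.finite_range a).bddBelow
  exact ⟨b, fun i j n hn ↦ ha (i, j) n (hn.trans_le (hb ⟨(i, j), rfl⟩))⟩

theorem coeff_J_of_ne_zero {l : Type*} [DecidableEq l] (i j : l ⊕ l) {n : ℤ} (hn : n ≠ 0) :
    (J l (LaurentSeries R) i j).coeff n = 0 := by
  rcases i with i | i <;> rcases j with j | j <;> by_cases h : i = j <;>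
    simp [J, h, HahnSeries.coeff_one, hn]

section Decomposition

variable [DecidableEq κ]

/-- The `R`-module of row vectors of the form `v + w h` where `v` has only negative exponents and
`w` has only nonnegative exponents. -/
def negAddPosMul (h : Matrix κ κ (LaurentSeries R)) : Submodule R (κ → LaurentSeries R) where
  carrier := {x | ∃ v w : κ → LaurentSeries R, (∀ i, ∀ n ≥ 0, (v i).coeff n = 0) ∧
    (∀ i, ∀ n < 0, (w i).coeff n = 0) ∧ x = v + w ᵥ* h}
  zero_mem' := ⟨0, 0, by simp⟩
  add_mem' := by
    rintro _ _ ⟨v, w, hv, hw, rfl⟩ ⟨v', w', hv', hw', rfl⟩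
    refine ⟨v + v', w + w', fun i n hn ↦ ?_, fun i n hn ↦ ?_, ?_⟩
    · simp [hv i n hn, hv' i n hn]
    · simp [hw i n hn, hw' i n hn]
    · rw [add_vecMul]; abel
  smul_mem' := by
    rintro c _ ⟨v, w, hv, hw, rfl⟩
    refine ⟨c • v, c • w, fun i n hn ↦ ?_, fun i n hn ↦ ?_, ?_⟩
    · simp [hv i n hn]
    · simp [hw i n hn]
    · have h1 (x : κ → LaurentSeries R) : c • x = HahnSeries.C (Γ := ℤ) c • x := by
        ext1 i
        exact HahnSeries.C_mul_eq_smul.symm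
      rw [h1, h1, h1, smul_vecMul, smul_add]

theorem exists_smul_mem_negAddPosMul {m : Ideal R} {g h : Matrix κ κ (LaurentSeries R)}
    (hgh : g * h = 1) (hh : (mapRingHom (Ideal.Quotient.mk m)).mapMatrix h = 1) :
    ∃ f : R, f - 1 ∈ m ∧ ∀ i, f • Pi.single i 1 ∈ negAddPosMul h := by
  obtain ⟨a, ha⟩ := exists_coeff_matrix_eq_zero g
  set d : ℕ := a.natAbs + 1 with hd
  let u (p : κ × Fin d) : κ → LaurentSeries R :=
    Pi.single p.1 (HahnSeries.single (p.2 : ℤ) 1)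
  have hu (p i) (n : ℤ) : (u p i).coeff n = if i = p.1 ∧ n = p.2 then 1 else 0 := by
    by_cases h1 : i = p.1
    · subst h1
      simp [u, HahnSeries.coeff_single]
    · simp [u, h1]
  set U := Submodule.span R (Set.range u)
  set W := negAddPosMul h
  have hm (v : κ → LaurentSeries R) (i n) : ((v - v ᵥ* h) i).coeff n ∈ m := by
    rw [← Ideal.Quotient.eq_zero_iff_mem]
    have h1 : (mapRingHom (Ideal.Quotient.mk m)) ∘ (v - v ᵥ* h) = 0 := by
      have h2 : (mapRingHom (Ideal.Quotient.mk m)) ∘ (v - v ᵥ* h) =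
          mapRingHom (Ideal.Quotient.mk m) ∘ v - mapRingHom (Ideal.Quotient.mk m) ∘ (v ᵥ* h) := by
        ext; simp
      have h3 := RingHom.map_vecMul (mapRingHom (Ideal.Quotient.mk m)) h v
      rw [h2, sub_eq_zero]
      ext1 i
      rw [Function.comp_apply, Function.comp_apply, h3, ← RingHom.mapMatrix_apply, hh, vecMul_one,
        Function.comp_apply]
    exact congr((($h1) i).coeff n)
  have key : U ≤ W ⊔ m • U := by
    rw [Submodule.span_le]
    rintro _ ⟨p, rfl⟩
    set y := u p - u p ᵥ* h with hy
    let ylow : κ → LaurentSeries R := fun i ↦ restrict (Set.Iio 0) (y i)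
    let yhigh : κ → LaurentSeries R := fun i ↦ restrict (Set.Ici (d : ℤ)) (y i)
    have hsplit : u p = (ylow + (u p + yhigh ᵥ* g) ᵥ* h) +
        ∑ q : κ × Fin d, (y q.1).coeff q.2 • u q := by
      rw [add_vecMul, vecMul_vecMul, hgh, vecMul_one]
      have : u p = y + u p ᵥ* h := by simp [hy]
      nth_rewrite 1 [this]
      have : y = ylow + yhigh + ∑ q : κ × Fin d, (y q.1).coeff q.2 • u q := by
        ext i n
        rw [Pi.add_apply, Finset.sum_apply, HahnSeries.coeff_add, HahnSeries.coeff_sum]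
        simp only [Pi.add_apply, HahnSeries.coeff_add, Pi.smul_apply, HahnSeries.coeff_smul, hu,
          ylow, yhigh, coeff_restrict, Set.mem_Iio, Set.mem_Ici, smul_eq_mul, mul_ite, mul_one,
          mul_zero]
        by_cases h0 : n < 0
        · have h1 : ¬ (d : ℤ) ≤ n := by lia
          rw [if_pos h0, if_neg h1, Finset.sum_eq_zero]
          · simp
          · intro q _
            rw [if_neg]
            rintro ⟨-, h2⟩
            lia
        · by_cases h1 : (d : ℤ) ≤ n
          · rw [if_neg h0, if_pos h1, Finset.sum_eq_zero]
            · simp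
            · intro q _
              rw [if_neg]
              rintro ⟨-, h2⟩
              have := q.2.2
              omega
          · rw [if_neg h0, if_neg h1, Finset.sum_eq_single (i, ⟨n.toNat, by lia⟩)]
            · rw [if_pos ⟨rfl, by simp; lia⟩]
              simp [Int.toNat_of_nonneg (not_lt.1 h0)]
            · rintro ⟨q1, q2⟩ _ hq
              rw [if_neg]
              rintro ⟨rfl, rfl⟩
              exact hq (by simp)
            · simp
      nth_rewrite 1 [this]
      abel
    rw [hsplit]
    refine Submodule.add_mem_sup ⟨ylow, _, fun i n hn ↦ ?_, fun i n hn ↦ ?_, rfl⟩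
      (Submodule.sum_mem _ fun q _ ↦
        Submodule.smul_mem_smul (hm _ _ _) (Submodule.subset_span ⟨q, rfl⟩))
    · rw [coeff_restrict, if_neg (by simpa using hn)]
    · rw [Pi.add_apply, HahnSeries.coeff_add, hu, if_neg (by lia), zero_add]
      have := coeff_matrix_mul_eq_zero (M := replicateRow Unit yhigh) (N := g) (a := d) (b := a)
        (fun _ j k hk ↦ by simp [yhigh, coeff_restrict, hk]) ha () i (n := n) (by lia)
      exact this
  obtain ⟨f, hf, hfU⟩ := Submodule.exists_sub_one_mem_and_smul_eq_zero_of_fg_of_le_smul m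
    (U.map W.mkQ) ((Submodule.fg_span (Set.finite_range u)).map _) (by
      rw [← Submodule.map_smul'']
      refine (Submodule.map_mono key).trans ?_
      rw [Submodule.map_sup, Submodule.mkQ_map_self, bot_sup_eq])
  refine ⟨f, hf, fun i ↦ ?_⟩
  have h1 := hfU _ (Submodule.mem_map_of_mem
    (Submodule.subset_span (R := R) (s := Set.range u) ⟨(i, ⟨0, by lia⟩), rfl⟩))
  rw [← map_smul, Submodule.mkQ_apply, Submodule.Quotient.mk_eq_zero] at h1
  simpa [u] using h1

end Decomposition

end LaurentSeries

namespace SymplecticGroup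

open Matrix HahnSeries
open LaurentPolynomial (toLaurentSeries toLaurentSeries_injective mem_range_toLaurentSeries)

variable {l R : Type*} [DecidableEq l] [Fintype l] [CommRing R]

/-- A symplectic matrix of Laurent series is the product of a matrix of Laurent polynomials and a
matrix of power series, both symplectic. -/
def Factors (g : symplecticGroup l (LaurentSeries R)) : Prop :=
  ∃ (a : symplecticGroup l (LaurentPolynomial R)) (b : symplecticGroup l (PowerSeries R)),
    map (toLaurentSeries R) a * map (ofPowerSeries ℤ R) b = g

theorem Factors.of_mul_mul {g : symplecticGroup l (LaurentSeries R)}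
    (a : symplecticGroup l (LaurentPolynomial R)) (b : symplecticGroup l (PowerSeries R))
    (h : Factors (map (toLaurentSeries R) a * g * map (ofPowerSeries ℤ R) b)) : Factors g := by
  obtain ⟨a', b', h⟩ := h
  refine ⟨a⁻¹ * a', b' * b⁻¹, ?_⟩
  rw [map_mul, map_mul, map_inv, map_inv, mul_assoc, ← mul_assoc (map _ a'), h]
  group

theorem factors_of_mul_eq {g : symplecticGroup l (LaurentSeries R)}
    {a b : Matrix (l ⊕ l) (l ⊕ l) (LaurentSeries R)} (h : a * g.1 = b)
    (ha : ∀ i j, ∀ n > -1, ((a - 1) i j).coeff n = 0)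
    (hb : ∀ i j, ∀ n < 0, (b i j).coeff n = 0) : Factors g := by
  have hg : g.1 * J l _ * g.1ᵀ = J l _ := mem_iff.1 g.2
  have hab : a * J l _ * aᵀ = b * J l _ * bᵀ := by
    rw [← h, transpose_mul]
    calc a * J l _ * aᵀ = a * (g.1 * J l _ * g.1ᵀ) * aᵀ := by rw [hg]
      _ = _ := by simp only [Matrix.mul_assoc]
  set c := a - 1 with hc
  have haJ : a * J l _ * aᵀ = J l _ + (c * J l _ + J l _ * cᵀ + c * J l _ * cᵀ) := by
    rw [hc, transpose_sub, transpose_one]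
    noncomm_ring
  have hJ0 : ∀ i j, ∀ n > (0 : ℤ), (J l (LaurentSeries R) i j).coeff n = 0 := fun i j n hn ↦
    LaurentSeries.coeff_J_of_ne_zero i j hn.ne'
  have hJ1 : ∀ i j, ∀ n < (0 : ℤ), (J l (LaurentSeries R) i j).coeff n = 0 := fun i j n hn ↦
    LaurentSeries.coeff_J_of_ne_zero i j hn.ne
  have hct : ∀ i j, ∀ n > (-1 : ℤ), (cᵀ i j).coeff n = 0 := fun i j ↦ ha j i
  have hbt : ∀ i j, ∀ n < (0 : ℤ), (bᵀ i j).coeff n = 0 := fun i j ↦ hb j i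
  have hcJ : ∀ i j, ∀ n > (-1 : ℤ), ((c * J l (LaurentSeries R)) i j).coeff n = 0 :=
    fun i j n hn ↦ LaurentSeries.coeff_matrix_mul_eq_zero_of_gt ha hJ0 i j (by lia)
  have hbJ : ∀ i j, ∀ n < (0 : ℤ), ((b * J l (LaurentSeries R)) i j).coeff n = 0 :=
    fun i j n hn ↦ LaurentSeries.coeff_matrix_mul_eq_zero hb hJ1 i j (by lia)
  have ha_mem : a ∈ symplecticGroup l (LaurentSeries R) := by
    rw [mem_iff]
    ext i j n
    rcases lt_or_ge n 0 with hn | hn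
    · rw [hJ1 i j n hn, hab]
      exact LaurentSeries.coeff_matrix_mul_eq_zero hbJ hbt i j (by lia)
    · rw [haJ, Matrix.add_apply, Matrix.add_apply, Matrix.add_apply, coeff_add, coeff_add,
        coeff_add, hcJ i j n (by lia),
        LaurentSeries.coeff_matrix_mul_eq_zero_of_gt hJ0 hct i j (by lia),
        LaurentSeries.coeff_matrix_mul_eq_zero_of_gt hcJ hct i j (by lia)]
      simp
  obtain ⟨a', ha'⟩ := exists_map_eq toLaurentSeries_injective (a := ⟨a, ha_mem⟩) fun i j ↦
    mem_range_toLaurentSeries (a := 0) fun n hn ↦ by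
      have h1 := ha i j n (by lia)
      rw [hc, Matrix.sub_apply, coeff_sub, sub_eq_zero] at h1
      rw [h1, one_apply]
      split_ifs <;> simp [coeff_one, ne_of_gt hn]
  obtain ⟨b', hb'⟩ := exists_map_eq ofPowerSeries_injective
    (a := ⟨b, h ▸ mul_mem ha_mem g.2⟩) fun i j ↦ LaurentSeries.mem_range_ofPowerSeries (hb i j)
  refine ⟨a'⁻¹, b', ?_⟩
  rw [map_inv, ha', hb', inv_mul_eq_iff_eq_mul]
  exact Subtype.ext h.symm

theorem exists_factors_map_of_map_mk_eq_one {m : Ideal R}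
    {g : symplecticGroup l (LaurentSeries R)}
    (hg : map (LaurentSeries.mapRingHom (Ideal.Quotient.mk m)) g = 1) :
    ∃ f : R, f - 1 ∈ m ∧ ∀ {S : Type*} [CommRing S] (φ : R →+* S), IsUnit (φ f) →
      Factors (map (LaurentSeries.mapRingHom φ) g) := by
  obtain ⟨f, hf, h⟩ := LaurentSeries.exists_smul_mem_negAddPosMul (m := m) (g := g.1) (h := g⁻¹.1)
    congr(($(mul_inv_cancel g)).1) (by
      have : map (LaurentSeries.mapRingHom (Ideal.Quotient.mk m)) g⁻¹ = 1 := by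
        rw [map_inv, hg, inv_one]
      exact congr(($this).1))
  choose v w hv hw h using h
  refine ⟨f, hf, fun {S} _ φ hφ ↦ ?_⟩
  obtain ⟨e, he⟩ := hφ
  set Φ := (LaurentSeries.mapRingHom φ).mapMatrix (m := l ⊕ l)
  have hΦ (c : R) (M : Matrix (l ⊕ l) (l ⊕ l) (LaurentSeries R)) :
      Φ (C (Γ := ℤ) c • M) = C (Γ := ℤ) (φ c) • Φ M := by
    ext i j
    simp [Φ]
  have h1 : C (Γ := ℤ) f • (1 : Matrix (l ⊕ l) (l ⊕ l) (LaurentSeries R)) =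
      Matrix.of v + Matrix.of w * g⁻¹.1 := by
    ext1 i j
    have := congr($(h i) j)
    rw [Matrix.add_apply, mul_apply, Matrix.smul_apply, smul_eq_mul, C_mul_eq_smul]
    simpa [vecMul, dotProduct, one_apply, Pi.single_apply, eq_comm] using this
  have h2 : C (Γ := ℤ) (φ f) • Φ g.1 = Φ (Matrix.of v) * Φ g.1 + Φ (Matrix.of w) := by
    have := congr(Φ ($h1 * g.1))
    rwa [add_mul, Matrix.mul_assoc, show g⁻¹.1 * g.1 = 1 from congr(($(inv_mul_cancel g)).1),
      Matrix.smul_mul, Matrix.one_mul, Matrix.mul_one, hΦ, map_add, _root_.map_mul] at this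
  refine factors_of_mul_eq (a := 1 - C (Γ := ℤ) (↑e⁻¹ : S) • Φ (Matrix.of v))
    (b := C (Γ := ℤ) (↑e⁻¹ : S) • Φ (Matrix.of w)) ?_ (fun i j n hn ↦ ?_) fun i j n hn ↦ ?_
  · rw [← sub_eq_iff_eq_add'] at h2
    rw [← h2, smul_sub, smul_smul, ← _root_.map_mul C, ← he, Units.inv_mul, _root_.map_one,
      one_smul, sub_mul, Matrix.one_mul, Matrix.smul_mul]
    rfl
  · rw [sub_sub_cancel_left, Matrix.neg_apply, Matrix.smul_apply, smul_eq_mul, C_mul_eq_smul]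
    simp [Φ, hv i j n (by lia)]
  · rw [Matrix.smul_apply, smul_eq_mul, C_mul_eq_smul]
    simp [Φ, hw i j n hn]

end SymplecticGroup

namespace LaurentPolynomial

variable {R S : Type*} [CommRing R] [CommRing S]

theorem exists_coeff_eq {φ : R →+* S} (hφ : Function.Surjective φ) (x : LaurentSeries S) (N : ℤ) :
    ∃ p : LaurentPolynomial R,
      ∀ n < N, (LaurentSeries.mapRingHom φ (toLaurentSeries R p) - x).coeff n = 0 := by
  obtain ⟨b, hb⟩ := LaurentSeries.exists_coeff_eq_zero x
  choose σ hσ using hφ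
  refine ⟨.ofCoeff (Finsupp.onFinset (Finset.Icc b N)
    (fun n ↦ if n ∈ Finset.Icc b N then σ (x.coeff n) else 0) fun n hn ↦ ?_), fun n hn ↦ ?_⟩
  · by_contra h
    simp [h] at hn
  · by_cases h : b ≤ n
    · simp [h, hn.le, hσ]
    · simp [h, hb n (not_le.1 h)]

end LaurentPolynomial

namespace SymplecticGroup

open Matrix HahnSeries
open LaurentPolynomial (toLaurentSeries)

variable {l R S : Type*} [DecidableEq l] [Fintype l] [CommRing R] [CommRing S]

theorem exists_coeff_sub_eq_zero {k : Type*} [Field k] {φ : R →+* k} (hφ : Function.Surjective φ)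
    (g : symplecticGroup l (LaurentSeries k)) (N : ℤ) :
    ∃ e : symplecticGroup l (LaurentPolynomial R), ∀ i j, ∀ n < N,
      (((map (LaurentSeries.mapRingHom φ) (map (toLaurentSeries R) e)).1 - g.1) i j).coeff n =
        0 := by
  set θ := (LaurentSeries.mapRingHom φ).comp (toLaurentSeries R) with hθ
  suffices h : ∀ N : ℤ, ∃ e : symplecticGroup l (LaurentPolynomial R), ∀ i j, ∀ n < N,
      ((θ.mapMatrix e.1 - g.1) i j).coeff n = 0 from h N
  clear N
  refine field_induction (fun M ↦ ∀ N : ℤ, ∃ e : symplecticGroup l (LaurentPolynomial R),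
    ∀ i j, ∀ n < N, ((θ.mapMatrix e.1 - M) i j).coeff n = 0) (fun X hX N ↦ ?_) (fun X hX N ↦ ?_)
    (fun t N ↦ ?_) (fun M₁ M₂ h₁ h₂ N ↦ ?_) g.2
  · choose F hF using fun x ↦ LaurentPolynomial.exists_coeff_eq hφ x N
    refine ⟨⟨_, upper_mem (X := X.map F) (hX.map F)⟩, fun i j n hn ↦ ?_⟩
    rcases i with i | i <;> rcases j with j | j
    · simp [fromBlocks_map, Matrix.map_one]
    · simpa [fromBlocks_map, θ] using hF (X i j) n hn
    · simp [fromBlocks_map]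
    · simp [fromBlocks_map, Matrix.map_one]
  · choose F hF using fun x ↦ LaurentPolynomial.exists_coeff_eq hφ x N
    refine ⟨⟨_, lower_mem (X := X.map F) (hX.map F)⟩, fun i j n hn ↦ ?_⟩
    rcases i with i | i <;> rcases j with j | j
    · simp [fromBlocks_map, Matrix.map_one]
    · simp [fromBlocks_map]
    · simpa [fromBlocks_map, θ] using hF (X i j) n hn
    · simp [fromBlocks_map, Matrix.map_one]
  · obtain ⟨i, j, hij, c⟩ := t
    obtain ⟨p, hp⟩ := LaurentPolynomial.exists_coeff_eq hφ c N
    let t' : TransvectionStruct l (LaurentPolynomial R) := ⟨i, j, hij, p⟩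
    refine ⟨⟨_, levi_mem (X := t'.toMatrix) (Y := t'.inv.toMatrixᵀ) ?_⟩, fun i' j' n hn ↦ ?_⟩
    · rw [← transpose_mul, TransvectionStruct.inv_mul, transpose_one]
    · have h := hp n hn
      rw [coeff_sub, sub_eq_zero] at h
      rcases i' with i' | i' <;> rcases j' with j' | j' <;>
        simp [t', fromBlocks_map, TransvectionStruct.toMatrix, TransvectionStruct.inv, transvection,
          Matrix.map_apply, single_apply, one_apply]
      · split_ifs with h'
        · simp [θ, h]
        · simp
      · split_ifs with h'
        · simp [θ, h]
        · simp
  · obtain ⟨b, hb⟩ := LaurentSeries.exists_coeff_matrix_eq_zero M₂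
    obtain ⟨e₁, he₁⟩ := h₁ (N - b)
    obtain ⟨b', hb'⟩ := LaurentSeries.exists_coeff_matrix_eq_zero (θ.mapMatrix e₁.1)
    obtain ⟨e₂, he₂⟩ := h₂ (N - b')
    refine ⟨e₁ * e₂, fun i j n hn ↦ ?_⟩
    have h : θ.mapMatrix (e₁ * e₂).1 - M₁ * M₂ =
        (θ.mapMatrix e₁.1 - M₁) * M₂ + θ.mapMatrix e₁.1 * (θ.mapMatrix e₂.1 - M₂) := by
      rw [Matrix.sub_mul, Matrix.mul_sub, ← _root_.map_mul]
      simp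
    rw [h, Matrix.add_apply, coeff_add,
      LaurentSeries.coeff_matrix_mul_eq_zero he₁ hb i j (by lia),
      LaurentSeries.coeff_matrix_mul_eq_zero hb' he₂ i j (by lia), add_zero]

theorem exists_map_powerSeries_eq {φ : R →+* S} (hφ : Function.Surjective φ)
    {h : symplecticGroup l (PowerSeries S)} (h1 : map PowerSeries.constantCoeff h = 1) :
    ∃ b : symplecticGroup l (PowerSeries R), map (PowerSeries.map φ) b = h := by
  obtain ⟨M, hM⟩ := h
  obtain ⟨A, B, C, D, rfl⟩ : ∃ A B C D, M = fromBlocks A B C D :=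
    ⟨_, _, _, _, (fromBlocks_toBlocks M).symm⟩
  have hlift (x : PowerSeries S) (a : R) (hx : φ a = PowerSeries.constantCoeff x) :
      ∃ y : PowerSeries R, PowerSeries.map φ y = x ∧ PowerSeries.constantCoeff y = a := by
    obtain ⟨y, rfl⟩ := PowerSeries.map_surjective φ hφ x
    refine ⟨y + PowerSeries.C (a - PowerSeries.constantCoeff y), ?_, by simp⟩
    rw [map_add, PowerSeries.map_C, map_sub, hx,
      ← PowerSeries.coeff_zero_eq_constantCoeff_apply, PowerSeries.coeff_map,
      PowerSeries.coeff_zero_eq_constantCoeff_apply, sub_self, map_zero, add_zero]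
  have hA1 : PowerSeries.constantCoeff.mapMatrix A = 1 := by
    ext i j
    have := congr(($h1).1 (Sum.inl i) (Sum.inl j))
    simpa [one_apply] using this
  have hA : IsUnit A.det := by
    rw [PowerSeries.isUnit_iff_constantCoeff, RingHom.map_det, hA1, det_one]
    exact isUnit_one
  choose A' hA' hA1' using fun i j ↦ hlift (A i j) ((1 : Matrix l l R) i j) (by
    have := congr($hA1 i j)
    rw [RingHom.mapMatrix_apply, Matrix.map_apply] at this
    rw [this, one_apply, one_apply]
    split_ifs <;> simp)
  have hdet : IsUnit (Matrix.of A').det := by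
    have : PowerSeries.constantCoeff.mapMatrix (Matrix.of A') = 1 := Matrix.ext hA1'
    rw [PowerSeries.isUnit_iff_constantCoeff, RingHom.map_det, this, det_one]
    exact isUnit_one
  have hmapA : (PowerSeries.map φ).mapMatrix (Matrix.of A') = A := Matrix.ext hA'
  choose F hF using PowerSeries.map_surjective φ hφ
  obtain ⟨hsC, hsB, hdec⟩ := eq_lower_mul_levi_mul_upper hA hM
  have hlevi : (Matrix.of A')ᵀ * (Matrix.of A')⁻¹ᵀ = 1 := by
    rw [← transpose_mul, nonsing_inv_mul _ hdet, transpose_one]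
  have hmapF (X : Matrix l l (PowerSeries S)) : (PowerSeries.map φ).mapMatrix (X.map F) = X := by
    ext1 i j
    exact hF _
  have hmapinv : (PowerSeries.map φ).mapMatrix (Matrix.of A')⁻¹ᵀ = A⁻¹ᵀ := by
    have := congr((PowerSeries.map φ).mapMatrix $(nonsing_inv_mul _ hdet))
    rw [_root_.map_mul, hmapA, _root_.map_one] at this
    rw [inv_eq_left_inv this]
    rfl
  refine ⟨⟨_, lower_mem (hsC.map F)⟩ * ⟨_, levi_mem hlevi⟩ * ⟨_, upper_mem (hsB.map F)⟩,
    Subtype.ext ?_⟩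
  refine Eq.trans ?_ hdec.symm
  rw [coe_map, Submonoid.coe_mul, Submonoid.coe_mul, _root_.map_mul, _root_.map_mul]
  simp only [RingHom.mapMatrix_apply, fromBlocks_map] at hmapA hmapF hmapinv ⊢
  rw [hmapA, hmapinv, hmapF, hmapF]
  simp [Matrix.map_one, Matrix.map_zero]

theorem exists_map_mk_mul_mul_eq_one (m : Ideal R) [m.IsMaximal]
    (g : symplecticGroup l (LaurentSeries R)) :
    ∃ (e : symplecticGroup l (LaurentPolynomial R)) (b : symplecticGroup l (PowerSeries R)),
      map (LaurentSeries.mapRingHom (Ideal.Quotient.mk m))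
        (map (toLaurentSeries R) e * g * map (ofPowerSeries ℤ R) b) = 1 := by
  let _ := Ideal.Quotient.field m
  set gm := map (LaurentSeries.mapRingHom (Ideal.Quotient.mk m)) g with hgm
  obtain ⟨a, ha⟩ := LaurentSeries.exists_coeff_matrix_eq_zero gm⁻¹.1
  obtain ⟨e, he⟩ := exists_coeff_sub_eq_zero (Ideal.Quotient.mk_surjective (I := m)) gm (1 - a)
  set em := map (LaurentSeries.mapRingHom (Ideal.Quotient.mk m)) (map (toLaurentSeries R) e)
  have hsub (i j) (n : ℤ) (hn : n < 1) : (((gm⁻¹ * em).1 - 1) i j).coeff n = 0 := by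
    have : (gm⁻¹ * em).1 - 1 = gm⁻¹.1 * (em.1 - gm.1) := by
      rw [Matrix.mul_sub, show gm⁻¹.1 * gm.1 = 1 from congr(($(inv_mul_cancel gm)).1)]
      rfl
    rw [this]
    exact LaurentSeries.coeff_matrix_mul_eq_zero ha he i j (by lia)
  have hcoeff (i j) (n : ℤ) (hn : n < 1) : ((gm⁻¹ * em).1 i j).coeff n =
      if i = j ∧ n = 0 then 1 else 0 := by
    have := hsub i j n hn
    rw [Matrix.sub_apply, coeff_sub, sub_eq_zero] at this
    rw [this, one_apply]
    by_cases h1 : i = j <;> by_cases h2 : n = 0 <;> simp [h1, h2]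
  obtain ⟨h, hh⟩ := exists_map_eq ofPowerSeries_injective (a := gm⁻¹ * em) fun i j ↦
    LaurentSeries.mem_range_ofPowerSeries fun n hn ↦ by
      rw [hcoeff i j n (by lia), if_neg (by lia)]
  obtain ⟨b, hb⟩ := exists_map_powerSeries_eq (Ideal.Quotient.mk_surjective (I := m)) (h := h) (by
    apply Subtype.ext
    ext i j
    have h1 := hcoeff i j 0 (by lia)
    rw [← hh, map_apply, LaurentSeries.coeff_ofPowerSeries] at h1
    rw [map_apply, ← PowerSeries.coeff_zero_eq_constantCoeff_apply]
    simpa [one_apply] using h1)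
  refine ⟨e⁻¹, b, ?_⟩
  rw [map_mul, map_mul, map_inv, map_inv, ← hgm,
    map_map_comm (φ := ofPowerSeries ℤ R) (LaurentSeries.mapRingHom_comp_ofPowerSeries _), hb, hh]
  change em⁻¹ * gm * (gm⁻¹ * em) = 1
  group

theorem exists_factors_map (m : Ideal R) [m.IsMaximal] (g : symplecticGroup l (LaurentSeries R)) :
    ∃ f : R, f ∉ m ∧ ∀ {S : Type*} [CommRing S] (φ : R →+* S), IsUnit (φ f) →
      Factors (map (LaurentSeries.mapRingHom φ) g) := by
  obtain ⟨e, b, heb⟩ := exists_map_mk_mul_mul_eq_one m g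
  obtain ⟨f, hf, h⟩ := exists_factors_map_of_map_mk_eq_one heb
  refine ⟨f, fun hfm ↦ ?_, fun φ hφ ↦ ?_⟩
  · exact (Ideal.ne_top_iff_one m).1 (Ideal.IsPrime.ne_top inferInstance)
      (by simpa using sub_mem hfm hf)
  · refine .of_mul_mul (map (LaurentPolynomial.mapRingHom φ) e) (map (PowerSeries.map φ) b) ?_
    have := h φ hφ
    rwa [map_mul, map_mul, map_map_comm (LaurentPolynomial.mapRingHom_comp_toLaurentSeries φ),
      map_map_comm (LaurentSeries.mapRingHom_comp_ofPowerSeries φ)] at this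

end SymplecticGroup

/-- The homomorphism `ψ` behaves like a localization away from `x`, except that the image of `x`
need not be a unit. -/
def IsAwayMap {D K : Type*} [CommRing D] [CommRing K] (ψ : D →+* K) (x : D) : Prop :=
  (∀ k, ∃ N, ψ x ^ N * k ∈ ψ.range) ∧ ∀ d, ψ d = 0 → ∃ N, x ^ N * d = 0

namespace IsAwayMap

open Filter Polynomial

variable {D K : Type*} [CommRing D] [CommRing K] {ψ : D →+* K} {x : D}

theorem of_isLocalization [Algebra D K] [IsLocalization.Away x K] :
    IsAwayMap (algebraMap D K) x := by
  refine ⟨fun k ↦ ?_, fun d hd ↦ ?_⟩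
  · obtain ⟨N, d, h⟩ := IsLocalization.Away.surj x k
    exact ⟨N, d, by rw [← h, mul_comm]⟩
  · obtain ⟨⟨_, N, rfl⟩, h⟩ := (IsLocalization.map_eq_zero_iff (Submonoid.powers x) K d).1 hd
    exact ⟨N, h⟩

theorem eventually_mem_range (h : IsAwayMap ψ x) (k : K) :
    ∀ᶠ N in atTop, ψ x ^ N * k ∈ ψ.range := by
  obtain ⟨N, d, hd⟩ := h.1 k
  filter_upwards [eventually_ge_atTop N] with M hM
  refine ⟨x ^ (M - N) * d, ?_⟩
  rw [map_mul, hd, map_pow, ← mul_assoc, ← pow_add, Nat.sub_add_cancel hM]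

theorem eventually_mul_eq_zero (h : IsAwayMap ψ x) {d : D} (hd : ψ d = 0) :
    ∀ᶠ N in atTop, x ^ N * d = 0 := by
  obtain ⟨N, hN⟩ := h.2 d hd
  filter_upwards [eventually_ge_atTop N] with M hM
  rw [← Nat.sub_add_cancel hM, pow_add, mul_assoc, hN, mul_zero]

theorem eventually_coeff_mem_range (h : IsAwayMap ψ x) (p : K[X]) :
    ∀ᶠ N in atTop, ∀ n, ψ x ^ N * p.coeff n ∈ ψ.range := by
  filter_upwards [(eventually_all_finset p.support).2 fun n _ ↦
    h.eventually_mem_range (p.coeff n)] with N hN n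
  by_cases hn : n ∈ p.support
  · exact hN n hn
  · rw [notMem_support_iff.1 hn, mul_zero]
    exact zero_mem _

theorem eventually_mul_coeff_eq_zero (h : IsAwayMap ψ x) {p : D[X]} (hp : p.map ψ = 0) :
    ∀ᶠ N in atTop, ∀ n, x ^ N * p.coeff n = 0 := by
  filter_upwards [(eventually_all_finset p.support).2 fun n _ ↦
    h.eventually_mul_eq_zero (d := p.coeff n) (by simpa using congr(($hp).coeff n))] with N hN n
  by_cases hn : n ∈ p.support
  · exact hN n hn
  · rw [notMem_support_iff.1 hn, mul_zero]

theorem polynomial (h : IsAwayMap ψ x) : IsAwayMap (mapRingHom ψ) (C x) := by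
  refine ⟨fun p ↦ ?_, fun p hp ↦ ?_⟩
  · obtain ⟨N, hN⟩ := (h.eventually_coeff_mem_range p).exists
    refine ⟨N, (mem_lifts _).1 ((lifts_iff_coeff_lifts _).2 fun n ↦ ?_)⟩
    rw [coe_mapRingHom, map_C, ← C_pow, coeff_C_mul]
    exact hN n
  · obtain ⟨N, hN⟩ := (h.eventually_mul_coeff_eq_zero hp).exists
    refine ⟨N, ?_⟩
    ext n
    rw [← C_pow, coeff_C_mul, hN, coeff_zero]

theorem eventually_exists_map_eq_comp (h : IsAwayMap ψ x) (p : K[X]) {d : D}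
    (hd : ψ d = p.coeff 0) :
    ∀ᶠ N in atTop, ∃ q : D[X], q.map ψ = p.comp (C (ψ x ^ N) * X) ∧ q.coeff 0 = d := by
  filter_upwards [h.eventually_coeff_mem_range p] with N hN
  choose c hc using hN
  have hq : (C (ψ x ^ N) * (divX p).comp (C (ψ x ^ N) * X)) ∈ lifts ψ := by
    refine (lifts_iff_coeff_lifts _).2 fun n ↦ ⟨x ^ (N * n) * c (n + 1), ?_⟩
    rw [map_mul, hc, coeff_C_mul, comp_C_mul_X_coeff, coeff_divX, map_pow]
    ring
  obtain ⟨q, hq⟩ := (mem_lifts _).1 hq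
  refine ⟨X * q + C d, ?_, by simp⟩
  conv_rhs => rw [← X_mul_divX_add p]
  simp only [Polynomial.map_add, Polynomial.map_mul, map_X, map_C, hq, hd, add_comp, mul_comp,
    X_comp, C_comp]
  ring

theorem eventually_comp_eq_zero (h : IsAwayMap ψ x) {p : D[X]} (hp : p.map ψ = 0)
    (hp0 : p.coeff 0 = 0) : ∀ᶠ N in atTop, p.comp (C (x ^ N) * X) = 0 := by
  filter_upwards [h.eventually_mul_coeff_eq_zero hp] with N hN
  ext n
  rw [comp_C_mul_X_coeff, coeff_zero]
  rcases n with _ | n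
  · simp [hp0]
  · rw [pow_succ, mul_comm, mul_assoc, hN, mul_zero]

end IsAwayMap

namespace SymplecticGroup

open Filter Matrix Polynomial

variable {l : Type*} [DecidableEq l] [Fintype l]

theorem eventually_exists_map_eq_eval {D K : Type*} [CommRing D] [CommRing K] {ψ : D →+* K} {x : D}
    (h : IsAwayMap ψ x) {ρ : symplecticGroup l K[X]} (hρ : map (evalRingHom 0) ρ = 1) :
    ∀ᶠ N in atTop, ∀ d : D, ∃ τ : symplecticGroup l D,
      map ψ τ = map (evalRingHom (ψ (x ^ N * d))) ρ := by
  have hρ' (i j) : ψ ((1 : Matrix (l ⊕ l) (l ⊕ l) D) i j) = (ρ.1 i j).coeff 0 := by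
    have := congr(($hρ).1 i j)
    rw [map_apply, coe_evalRingHom, ← coeff_zero_eq_eval_zero] at this
    rw [this, one_apply]
    split_ifs with h <;> simp [h]
  obtain ⟨N, hN⟩ := (eventually_all.2 fun i ↦ eventually_all.2 fun j ↦
    h.eventually_exists_map_eq_comp (ρ.1 i j) (hρ' i j)).exists
  choose P hP hP0 using hN
  set Q := Matrix.of P * J l _ * (Matrix.of P)ᵀ - J l _ with hQ
  have hQmap : (mapRingHom ψ).mapMatrix Q = 0 := by
    have h1 : (mapRingHom ψ).mapMatrix (Matrix.of P) =
        (map (compRingHom (C (ψ x ^ N) * X)) ρ).1 := Matrix.ext hP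
    have h2 := mem_iff.1 (map (compRingHom (C (ψ x ^ N) * X)) ρ).2
    rw [← h1] at h2
    rw [hQ, _root_.map_sub, _root_.map_mul, _root_.map_mul, sub_eq_zero]
    convert h2 using 1
    · rw [← map_J l (mapRingHom ψ)]; rfl
    · exact map_J l (mapRingHom ψ)
  have hQ0 : constantCoeff.mapMatrix Q = 0 := by
    have h1 : constantCoeff.mapMatrix (Matrix.of P) = 1 := Matrix.ext hP0
    have h2 : constantCoeff.mapMatrix (Matrix.of P)ᵀ = 1 := by
      have := congr(($h1)ᵀ)
      rwa [transpose_one] at this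
    rw [hQ, _root_.map_sub, _root_.map_mul, _root_.map_mul, h1, h2]
    simp
  have hQcomp : ∀ᶠ M in atTop, ∀ i j, (Q i j).comp (C (x ^ M) * X) = 0 :=
    eventually_all.2 fun i ↦ eventually_all.2 fun j ↦
      h.eventually_comp_eq_zero congr($hQmap i j) congr($hQ0 i j)
  filter_upwards [(tendsto_sub_atTop_nat N).eventually hQcomp, eventually_ge_atTop N]
    with M hM hNM d
  have hmem : (evalRingHom (x ^ (M - N) * d)).mapMatrix (Matrix.of P) ∈ symplecticGroup l D := by
    rw [mem_iff, ← map_J l (evalRingHom (x ^ (M - N) * d)), ← sub_eq_zero]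
    have h1 : (evalRingHom (x ^ (M - N) * d)).mapMatrix Q = 0 := by
      ext i j
      simpa using congr(($(hM i j)).eval d)
    rw [hQ, _root_.map_sub, _root_.map_mul, _root_.map_mul] at h1
    exact h1
  refine ⟨⟨_, hmem⟩, Subtype.ext <| Matrix.ext fun i j ↦ ?_⟩
  have h1 := congr(($(hP i j)).eval (ψ (x ^ (M - N) * d)))
  rw [eval_map_apply, eval_comp] at h1
  rw [map_apply, map_apply]
  refine h1.trans ?_
  rw [coe_evalRingHom, eval_mul, eval_C, eval_X, ← map_pow, ← map_mul, ← mul_assoc, ← pow_add,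
    Nat.add_sub_cancel' hNM]

theorem exists_mul_eq_of_map_eval_one {B F H K : Type*} [CommRing B] [CommRing F] [CommRing H]
    [CommRing K] {iF : B →+* F} {iH : B →+* H} {ψF : F →+* K} {ψH : H →+* K}
    (hcomm : ψF.comp iF = ψH.comp iH) {f h : B} (hF : IsAwayMap ψF (iF h))
    (hH : IsAwayMap ψH (iH f)) (hfh : IsCoprime f h) {σ : symplecticGroup l K[X]}
    (hσ : map (evalRingHom 1) σ = 1) :
    ∃ (τF : symplecticGroup l F[X]) (τH : symplecticGroup l H[X]),
      map (mapRingHom ψF) τF * map (mapRingHom ψH) τH = σ := by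
  let ρH : symplecticGroup l K[X][X] := map (eval₂RingHom (C.comp C) (1 + X * C (X - 1))) σ
  let ρF : symplecticGroup l K[X][X] :=
    map C σ * (map (eval₂RingHom (C.comp C) (C X - X * C (X - 1))) σ)⁻¹
  have hρH (c : K[X]) : map (evalRingHom c) ρH = map (compRingHom (1 + c * (X - 1))) σ := by
    rw [map_map]
    congr 2
    ext <;> simp
  have hρF (c : K[X]) : map (evalRingHom c) ρF =
      σ * (map (compRingHom (X - c * (X - 1))) σ)⁻¹ := by
    rw [map_mul, map_inv, map_map, map_map]
    congr 1
    · have : (evalRingHom c).comp C = RingHom.id _ := by ext <;> simp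
      rw [this]
      rfl
    · congr 3
      ext <;> simp
  have hρH0 : map (evalRingHom 0) ρH = 1 := by
    rw [hρH, zero_mul, add_zero]
    have : compRingHom (1 : K[X]) = C.comp (evalRingHom 1) := by ext <;> simp
    rw [this, ← map_map, hσ, map_one]
  have hρF0 : map (evalRingHom 0) ρF = 1 := by
    rw [hρF, zero_mul, sub_zero]
    have : compRingHom (X : K[X]) = RingHom.id _ := by ext <;> simp
    rw [this]
    exact mul_inv_cancel σ
  obtain ⟨N, hNF, hNH⟩ := ((eventually_exists_map_eq_eval hF.polynomial hρF0).and
    (eventually_exists_map_eq_eval hH.polynomial hρH0)).exists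
  obtain ⟨α, β, hαβ⟩ := hfh.pow (m := N) (n := N)
  obtain ⟨τF, hτF⟩ := hNF (C (iF β))
  obtain ⟨τH, hτH⟩ := hNH (C (iH α))
  refine ⟨τF, τH, ?_⟩
  have hc : mapRingHom ψF (C (iF h) ^ N * C (iF β)) + mapRingHom ψH (C (iH f) ^ N * C (iH α)) =
      1 := by
    have h1 (b : B) : ψF (iF b) = ψH (iH b) := congr($hcomm b)
    simp only [coe_mapRingHom, map_C, ← map_pow, ← _root_.map_mul]
    rw [h1, ← C_add, ← _root_.map_add, ← _root_.map_add]
    rw [show h ^ N * β + f ^ N * α = 1 by rw [← hαβ]; ring]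
    simp
  rw [hτF, hτH, hρF, hρH, eq_sub_iff_add_eq'.2 hc,
    show 1 + (1 - mapRingHom ψF (C (iF h) ^ N * C (iF β))) * (X - 1) =
      X - mapRingHom ψF (C (iF h) ^ N * C (iF β)) * (X - 1) by ring, inv_mul_cancel_right]

end SymplecticGroup

namespace LaurentPolynomial

theorem toLaurentSeries_comp_C {R : Type*} [CommRing R] :
    (toLaurentSeries R).comp C = (HahnSeries.ofPowerSeries ℤ R).comp PowerSeries.C := by
  apply RingHom.ext
  intro a
  have := toLaurentSeries_C_mul_T a 0
  rw [T_zero, mul_one] at this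
  rw [RingHom.comp_apply, RingHom.comp_apply, this, HahnSeries.ofPowerSeries_C]
  rfl

theorem toLaurentSeries_comp_toLaurent {R : Type*} [CommRing R] :
    (toLaurentSeries R).comp Polynomial.toLaurent =
      (HahnSeries.ofPowerSeries ℤ R).comp Polynomial.coeToPowerSeries.ringHom :=
  RingHom.ext toLaurentSeries_toLaurent

theorem exists_mapRingHom_eq {B F H K : Type*} [CommRing B] [CommRing F] [CommRing H]
    [CommRing K] {iF : B →+* F} {iH : B →+* H} {ψF : F →+* K} {ψH : H →+* K}
    (hglue : ∀ x y, ψF x = ψH y → ∃ b, iF b = x ∧ iH b = y)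
    {p : LaurentPolynomial F} {q : LaurentPolynomial H}
    (hpq : mapRingHom ψF p = mapRingHom ψH q) :
    ∃ r : LaurentPolynomial B, mapRingHom iF r = p ∧ mapRingHom iH r = q := by
  choose b hbF hbH using fun n ↦ hglue (p.coeff n) (q.coeff n) (by
    rw [← coeff_mapRingHom, ← coeff_mapRingHom, hpq])
  refine ⟨.ofCoeff (Finsupp.onFinset (p.coeff.support ∪ q.coeff.support)
    (fun n ↦ if n ∈ p.coeff.support ∪ q.coeff.support then b n else 0) fun n hn ↦ ?_),
    LaurentPolynomial.ext fun n ↦ ?_, LaurentPolynomial.ext fun n ↦ ?_⟩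
  · by_contra h
    simp [h] at hn
  all_goals
    by_cases h : n ∈ p.coeff.support ∪ q.coeff.support
    · simp [h, hbF, hbH]
    · rw [Finset.notMem_union, Finsupp.notMem_support_iff, Finsupp.notMem_support_iff] at h
      simp [h]

end LaurentPolynomial

namespace SymplecticGroup

open Matrix HahnSeries
open LaurentPolynomial (toLaurentSeries evalOne)

universe u

variable {l : Type*} [DecidableEq l] [Fintype l]

theorem exists_evalOne_eq_one_of_factors {R : Type*} [CommRing R]
    {g : symplecticGroup l (LaurentSeries R)} (hg : Factors g) :
    ∃ (a : symplecticGroup l (LaurentPolynomial R)) (b : symplecticGroup l (PowerSeries R)),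
      map (evalOne R) a = 1 ∧ map (toLaurentSeries R) a * map (ofPowerSeries ℤ R) b = g := by
  obtain ⟨a, b, rfl⟩ := hg
  refine ⟨a * (map LaurentPolynomial.C (map (evalOne R) a))⁻¹,
    map PowerSeries.C (map (evalOne R) a) * b, ?_, ?_⟩
  · rw [map_mul, map_inv, map_map LaurentPolynomial.C, LaurentPolynomial.evalOne_comp_C]
    exact mul_inv_cancel _
  · rw [map_mul, map_mul, map_inv, map_map_comm LaurentPolynomial.toLaurentSeries_comp_C]
    group

theorem factors_of_map_eq {B F H K : Type*} [CommRing B] [CommRing F] [CommRing H]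
    [CommRing K] {iF : B →+* F} {iH : B →+* H} {ψF : F →+* K} {ψH : H →+* K}
    (hinj : ∀ b, iF b = 0 → iH b = 0 → b = 0)
    (hglue : ∀ x y, ψF x = ψH y → ∃ b, iF b = x ∧ iH b = y)
    {g : symplecticGroup l (LaurentSeries B)}
    {aF : symplecticGroup l (LaurentPolynomial F)} {bF : symplecticGroup l (PowerSeries F)}
    {aH : symplecticGroup l (LaurentPolynomial H)} {bH : symplecticGroup l (PowerSeries H)}
    (hgF : map (toLaurentSeries F) aF * map (ofPowerSeries ℤ F) bF =
      map (LaurentSeries.mapRingHom iF) g)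
    (hgH : map (toLaurentSeries H) aH * map (ofPowerSeries ℤ H) bH =
      map (LaurentSeries.mapRingHom iH) g)
    (hK : map (LaurentPolynomial.mapRingHom ψF) aF = map (LaurentPolynomial.mapRingHom ψH) aH) :
    Factors g := by
  choose r hrF hrH using fun i j ↦ LaurentPolynomial.exists_mapRingHom_eq hglue
    congr(($hK).1 i j)
  have hrF' : (LaurentPolynomial.mapRingHom iF).mapMatrix (Matrix.of r) = aF.1 := Matrix.ext hrF
  have hrH' : (LaurentPolynomial.mapRingHom iH).mapMatrix (Matrix.of r) = aH.1 := Matrix.ext hrH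
  have hmem : Matrix.of r ∈ symplecticGroup l (LaurentPolynomial B) :=
    mem_of_map_mem (φ := LaurentPolynomial.mapRingHom iF) (ψ := LaurentPolynomial.mapRingHom iH)
      (fun x hx hx' ↦ LaurentPolynomial.ext fun n ↦
        hinj _ (by simpa using congr(($hx).coeff n)) (by simpa using congr(($hx').coeff n)))
      (hrF' ▸ Subtype.coe_prop _) (hrH' ▸ Subtype.coe_prop _)
  let a : symplecticGroup l (LaurentPolynomial B) := ⟨Matrix.of r, hmem⟩
  have haF : map (LaurentPolynomial.mapRingHom iF) a = aF := Subtype.ext hrF'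
  have haH : map (LaurentPolynomial.mapRingHom iH) a = aH := Subtype.ext hrH'
  have hbF : map (LaurentSeries.mapRingHom iF) ((map (toLaurentSeries B) a)⁻¹ * g) =
      map (ofPowerSeries ℤ F) bF := by
    rw [map_mul, map_inv, map_map_comm (LaurentPolynomial.mapRingHom_comp_toLaurentSeries _), haF,
      ← hgF, inv_mul_cancel_left]
  have hbH : map (LaurentSeries.mapRingHom iH) ((map (toLaurentSeries B) a)⁻¹ * g) =
      map (ofPowerSeries ℤ H) bH := by
    rw [map_mul, map_inv, map_map_comm (LaurentPolynomial.mapRingHom_comp_toLaurentSeries _), haH,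
      ← hgH, inv_mul_cancel_left]
  obtain ⟨b, hb⟩ := exists_map_eq ofPowerSeries_injective
    (a := (map (toLaurentSeries B) a)⁻¹ * g) fun i j ↦
      LaurentSeries.mem_range_ofPowerSeries fun n hn ↦ hinj _
        (by
          have := congr((($hbF).1 i j).coeff n)
          rwa [map_apply, map_apply, LaurentSeries.coeff_ofPowerSeries_of_neg _ hn] at this)
        (by
          have := congr((($hbH).1 i j).coeff n)
          rwa [map_apply, map_apply, LaurentSeries.coeff_ofPowerSeries_of_neg _ hn] at this)
  exact ⟨a, b, by rw [hb, mul_inv_cancel_left]⟩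

theorem exists_mul_map_toLaurent_eq {K : Type*} [CommRing K]
    {a a' : symplecticGroup l (LaurentPolynomial K)} {b b' : symplecticGroup l (PowerSeries K)}
    (ha : map (evalOne K) a = 1) (ha' : map (evalOne K) a' = 1)
    (h : map (toLaurentSeries K) a * map (ofPowerSeries ℤ K) b =
      map (toLaurentSeries K) a' * map (ofPowerSeries ℤ K) b') :
    ∃ σ : symplecticGroup l (Polynomial K),
      map (Polynomial.evalRingHom 1) σ = 1 ∧ a * map Polynomial.toLaurent σ = a' := by
  have hrange : map (toLaurentSeries K) (a⁻¹ * a') = map (ofPowerSeries ℤ K) (b * b'⁻¹) := by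
    rw [map_mul, map_inv, map_mul, map_inv, inv_mul_eq_iff_eq_mul, ← mul_assoc, h,
      mul_inv_cancel_right]
  obtain ⟨σ, hσ⟩ := exists_map_eq Polynomial.toLaurent_injective (a := a⁻¹ * a') fun i j ↦
    LaurentPolynomial.mem_range_toLaurent fun n hn ↦ by
      rw [← LaurentPolynomial.coeff_toLaurentSeries, ← map_apply, hrange, map_apply,
        LaurentSeries.coeff_ofPowerSeries_of_neg _ hn]
  refine ⟨σ, ?_, by rw [hσ, mul_inv_cancel_left]⟩
  have h1 : Polynomial.evalRingHom 1 = (evalOne K).comp Polynomial.toLaurent :=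
    RingHom.ext fun p ↦ (LaurentPolynomial.evalOne_toLaurent p).symm
  rw [h1, ← map_map, hσ, map_mul, map_inv, ha, ha', inv_one, one_mul]

theorem factors_of_glue {B F H K : Type*} [CommRing B] [CommRing F] [CommRing H]
    [CommRing K] {iF : B →+* F} {iH : B →+* H} {ψF : F →+* K} {ψH : H →+* K}
    (hcomm : ψF.comp iF = ψH.comp iH) {f h : B} (hF : IsAwayMap ψF (iF h))
    (hH : IsAwayMap ψH (iH f)) (hfh : IsCoprime f h) (hinj : ∀ b, iF b = 0 → iH b = 0 → b = 0)
    (hglue : ∀ x y, ψF x = ψH y → ∃ b, iF b = x ∧ iH b = y)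
    {g : symplecticGroup l (LaurentSeries B)}
    (hgF : Factors (map (LaurentSeries.mapRingHom iF) g))
    (hgH : Factors (map (LaurentSeries.mapRingHom iH) g)) : Factors g := by
  obtain ⟨aF, bF, haF, hgF⟩ := exists_evalOne_eq_one_of_factors hgF
  obtain ⟨aH, bH, haH, hgH⟩ := exists_evalOne_eq_one_of_factors hgH
  have hFK := congr(map (LaurentSeries.mapRingHom ψF) $hgF)
  have hHK := congr(map (LaurentSeries.mapRingHom ψH) $hgH)
  have hcomm' : (LaurentSeries.mapRingHom ψF).comp (LaurentSeries.mapRingHom iF) =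
      (LaurentSeries.mapRingHom ψH).comp (LaurentSeries.mapRingHom iH) := by
    rw [LaurentSeries.mapRingHom_comp_mapRingHom, hcomm, LaurentSeries.mapRingHom_comp_mapRingHom]
  rw [map_mul, map_map_comm (LaurentPolynomial.mapRingHom_comp_toLaurentSeries _),
    map_map_comm (φ := ofPowerSeries ℤ F) (LaurentSeries.mapRingHom_comp_ofPowerSeries _)] at hFK
  rw [map_mul, map_map_comm (LaurentPolynomial.mapRingHom_comp_toLaurentSeries _),
    map_map_comm (φ := ofPowerSeries ℤ H) (LaurentSeries.mapRingHom_comp_ofPowerSeries _)] at hHK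
  rw [map_map_comm hcomm', ← hHK] at hFK
  obtain ⟨σ, hσ1, hσ⟩ := exists_mul_map_toLaurent_eq
    (by rw [map_map_comm (LaurentPolynomial.evalOne_comp_mapRingHom _), haF, map_one])
    (by rw [map_map_comm (LaurentPolynomial.evalOne_comp_mapRingHom _), haH, map_one]) hFK
  obtain ⟨τF, τH, hτ⟩ := exists_mul_eq_of_map_eval_one hcomm hF hH hfh hσ1
  have hK : map (LaurentPolynomial.mapRingHom ψF) (aF * map Polynomial.toLaurent τF) =
      map (LaurentPolynomial.mapRingHom ψH) (aH * (map Polynomial.toLaurent τH)⁻¹) := by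
    rw [← hτ, map_mul, ← mul_assoc] at hσ
    rw [map_mul, map_mul, map_inv, map_map_comm (LaurentPolynomial.mapRingHom_comp_toLaurent _),
      map_map_comm (LaurentPolynomial.mapRingHom_comp_toLaurent _), eq_mul_inv_iff_mul_eq, hσ]
  refine factors_of_map_eq hinj hglue (bF := (map Polynomial.coeToPowerSeries.ringHom τF)⁻¹ * bF)
    (bH := map Polynomial.coeToPowerSeries.ringHom τH * bH) ?_ ?_ hK
  · rw [← hgF, map_mul, map_mul, map_inv,
      map_map_comm LaurentPolynomial.toLaurentSeries_comp_toLaurent]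
    group
  · rw [← hgH, map_mul, map_mul, map_inv,
      map_map_comm LaurentPolynomial.toLaurentSeries_comp_toLaurent]
    group

theorem factors_of_isCoprime {B : Type*} [CommRing B] {f h : B} (hfh : IsCoprime f h)
    {g : symplecticGroup l (LaurentSeries B)}
    (hgF : Factors (map (LaurentSeries.mapRingHom (algebraMap B (Localization.Away f))) g))
    (hgH : Factors (map (LaurentSeries.mapRingHom (algebraMap B (Localization.Away h))) g)) :
    Factors g := by
  let K := Localization.Away (algebraMap B (Localization.Away h) f)
  have hf : IsUnit (algebraMap B K f) := by
    rw [IsScalarTower.algebraMap_apply B (Localization.Away h) K]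
    exact IsLocalization.Away.algebraMap_isUnit _
  let _ : Algebra (Localization.Away f) K := (IsLocalization.Away.lift f hf).toAlgebra
  have : IsScalarTower B (Localization.Away f) K :=
    .of_algebraMap_eq' (IsLocalization.Away.lift_comp f hf).symm
  have : IsLocalization.Away (algebraMap B (Localization.Away f) h) K :=
    IsLocalization.Away.commutes (Localization.Away f) (Localization.Away h) K f h
  have hF : IsAwayMap (algebraMap (Localization.Away f) K) (algebraMap B _ h) :=
    .of_isLocalization
  have hH : IsAwayMap (algebraMap (Localization.Away h) K) (algebraMap B _ f) :=
    .of_isLocalization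
  have hBF : IsAwayMap (algebraMap B (Localization.Away f)) f := .of_isLocalization
  have hBH : IsAwayMap (algebraMap B (Localization.Away h)) h := .of_isLocalization
  refine factors_of_glue (ψF := algebraMap (Localization.Away f) K)
    (ψH := algebraMap (Localization.Away h) K) ?_ hF hH hfh (fun b hb hb' ↦ ?_)
    (fun x y hxy ↦ ?_) hgF hgH
  · rw [← IsScalarTower.algebraMap_eq, ← IsScalarTower.algebraMap_eq]
  · obtain ⟨N, hN⟩ := hBF.2 b hb
    obtain ⟨M, hM⟩ := hBH.2 b hb'
    obtain ⟨α, β, hαβ⟩ := hfh.pow (m := N) (n := M)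
    linear_combination α * hN + β * hM - b * hαβ
  · obtain ⟨N, ⟨p, hp⟩, ⟨q, hq⟩⟩ :=
      ((hBF.eventually_mem_range x).and (hBH.eventually_mem_range y)).exists
    obtain ⟨M, hM⟩ := hH.2 (algebraMap B _ (h ^ N * p - f ^ N * q)) (by
      rw [← IsScalarTower.algebraMap_apply, map_sub, sub_eq_zero, _root_.map_mul, _root_.map_mul,
        IsScalarTower.algebraMap_apply B (Localization.Away f) K p,
        IsScalarTower.algebraMap_apply B (Localization.Away h) K q, hp, hq, _root_.map_mul,
        _root_.map_mul, hxy]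
      simp only [map_pow, ← IsScalarTower.algebraMap_apply]
      ring)
    rw [← map_pow, ← _root_.map_mul] at hM
    obtain ⟨M', hM'⟩ := hBH.2 _ hM
    obtain ⟨α, β, hαβ⟩ := hfh.pow (m := N + M) (n := N + M')
    refine ⟨α * (f ^ M * p) + β * (h ^ M' * q), ?_, ?_⟩
    · refine ((IsLocalization.Away.algebraMap_isUnit (S := Localization.Away f) f).pow
        (N + M)).mul_left_cancel ?_
      rw [_root_.pow_add, mul_right_comm _ _ x, ← hp, ← map_pow, ← map_pow, ← _root_.map_mul,
        ← _root_.map_mul, ← _root_.map_mul]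
      congr 1
      linear_combination f ^ M * p * hαβ - β * hM'
    · refine ((IsLocalization.Away.algebraMap_isUnit (S := Localization.Away h) h).pow
        (N + M')).mul_left_cancel ?_
      rw [_root_.pow_add, mul_right_comm _ _ y, ← hq, ← map_pow, ← map_pow, ← _root_.map_mul,
        ← _root_.map_mul, ← _root_.map_mul]
      congr 1
      linear_combination h ^ M' * q * hαβ + α * hM'

/-- The ideal of elements whose inversion makes a symplectic matrix of Laurent series factor. -/
def factorsIdeal {A : Type u} [CommRing A] (g : symplecticGroup l (LaurentSeries A)) : Ideal A where
  carrier := {f | ∀ (B : Type u) [CommRing B] (φ : A →+* B), IsUnit (φ f) →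
    Factors (map (LaurentSeries.mapRingHom φ) g)}
  zero_mem' B _ φ h := by
    rw [map_zero, isUnit_zero_iff] at h
    have := subsingleton_of_zero_eq_one h
    exact ⟨1, 1, Subtype.ext (Matrix.ext fun i j ↦ HahnSeries.ext (Subsingleton.elim _ _))⟩
  add_mem' {f h} hf hh B _ φ hu := by
    obtain ⟨u, hu⟩ := hu.exists_left_inv
    rw [map_add, mul_add] at hu
    refine factors_of_isCoprime ⟨u, u, hu⟩ ?_ ?_
    · rw [map_map, LaurentSeries.mapRingHom_comp_mapRingHom]
      exact hf _ _ (IsLocalization.Away.algebraMap_isUnit (S := Localization.Away (φ f)) (φ f))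
    · rw [map_map, LaurentSeries.mapRingHom_comp_mapRingHom]
      exact hh _ _ (IsLocalization.Away.algebraMap_isUnit (S := Localization.Away (φ h)) (φ h))
  smul_mem' c f hf B _ φ h := hf B φ <| by
    rw [smul_eq_mul, _root_.map_mul] at h
    exact isUnit_of_mul_isUnit_right h

/-- Every symplectic matrix of Laurent series is the product of a symplectic matrix of Laurent
polynomials and a symplectic matrix of power series. -/
theorem factors {A : Type u} [CommRing A] (g : symplecticGroup l (LaurentSeries A)) :
    Factors g := by
  have htop : factorsIdeal g = ⊤ := by
    by_contra h
    obtain ⟨m, hm, hle⟩ := Ideal.exists_le_maximal _ h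
    obtain ⟨f, hf, h⟩ := exists_factors_map m g
    exact hf (hle fun B _ φ hφ ↦ h φ hφ)
  have h1 : (1 : A) ∈ factorsIdeal g := htop ▸ Submodule.mem_top
  exact h1 A (RingHom.id A) (by simp)

end SymplecticGroup

/-- `Sp_{2n}(A((t))) = Sp_{2n}(A[t, t⁻¹]) · Sp_{2n}(A⟦t⟧)`: every symplectic matrix over
the Laurent series ring factors as a polynomial loop times a positive loop. -/
theorem Sp_laurentSeries_factorization (A : Type*) [CommRing A] (n : ℕ)
    (g : Matrix (Fin n ⊕ Fin n) (Fin n ⊕ Fin n)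
      (Localization.Away (PowerSeries.X : PowerSeries A)))
    (hg : g ∈ Matrix.symplecticGroup (Fin n)
      (Localization.Away (PowerSeries.X : PowerSeries A))) :
    ∃ (a : Matrix (Fin n ⊕ Fin n) (Fin n ⊕ Fin n) (LaurentPolynomial A))
      (b : Matrix (Fin n ⊕ Fin n) (Fin n ⊕ Fin n) (PowerSeries A)),
      a ∈ Matrix.symplecticGroup (Fin n) (LaurentPolynomial A) ∧
      b ∈ Matrix.symplecticGroup (Fin n) (PowerSeries A) ∧
      g = (laurentInclusion A).mapMatrix a *
          (algebraMap (PowerSeries A)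
            (Localization.Away (PowerSeries.X : PowerSeries A))).mapMatrix b := by
  let e := IsLocalization.algEquiv (Submonoid.powers (PowerSeries.X : PowerSeries A))
    (Localization.Away (PowerSeries.X : PowerSeries A)) (LaurentSeries A)
  obtain ⟨a, b, h⟩ := SymplecticGroup.factors
    (SymplecticGroup.map e.toRingEquiv.toRingHom ⟨g, hg⟩)
  have he : HahnSeries.ofPowerSeries ℤ A = e.toRingEquiv.toRingHom.comp (algebraMap _ _) :=
    RingHom.ext fun x ↦ (e.commutes x).symm
  rw [he, LaurentPolynomial.toLaurentSeries, ← SymplecticGroup.map_map,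
    ← SymplecticGroup.map_map, ← map_mul] at h
  exact ⟨a.1, b.1, a.2, b.2,
    congr(($(SymplecticGroup.map_injective e.toRingEquiv.injective h)).1).symm⟩
end

section
/- Let A be a commutative ring. Every unit of the Laurent series ring A((t)) factors as a Laurent polynomial unit times a power series unit: for every u ∈ (A((t)))ˣ there exist p ∈ (A[t, t⁻¹])ˣ and q ∈ (A⟦t⟧)ˣ such that u equals the product of the images of p and q under the canonical ring homomorphisms A[t, t⁻¹] → A((t)) and A⟦t⟧ → A((t)). -/
namespace PowerSeries

/-- The products `aₘ b_{N - m}` of complementary coefficients of two power series. When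
`f * g = X ^ N` over a domain, exactly one of them is nonzero and it marks the order of `f`. -/
noncomputable def orderWeight {A : Type*} [CommRing A] (f g : PowerSeries A) (N m : ℕ) : A :=
  coeff m f * coeff (N - m) g

/-- The weighted sum of the left shifts of `f`. -/
noncomputable def weightedShift {A : Type*} [CommRing A] (f g : PowerSeries A) (N : ℕ) :
    PowerSeries A :=
  mk fun i => ∑ m ∈ Finset.range (N + 1), orderWeight f g N m * coeff (i + m) f

/-- The weighted sum of the monomials `X ^ (N - m)`. -/
noncomputable def weightedMonomial {A : Type*} [CommRing A] (f g : PowerSeries A) (N : ℕ) :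
    Polynomial A :=
  ∑ m ∈ Finset.range (N + 1), Polynomial.C (orderWeight f g N m) * Polynomial.X ^ (N - m)

theorem exists_map_eq_X_pow_mul_weightedShift {A D : Type*} [CommRing A] [CommRing D] [IsDomain D]
    (φ : A →+* D) {f g : PowerSeries A} {N : ℕ} (hfg : f * g = X ^ N) :
    ∃ n ≤ N, map φ f = X ^ n * map φ (weightedShift f g N) ∧
      IsUnit (map φ (weightedShift f g N)) ∧
      (weightedMonomial f g N).map φ = Polynomial.X ^ (N - n) := by
  have hmap : map φ f * map φ g = 1 * X ^ N := by
    rw [← map_mul, hfg, map_pow, map_X, one_mul]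
  obtain ⟨n, k, b, c, hN, hbc, hf, hg⟩ := mul_eq_mul_prime_pow X_prime hmap
  have hbc0 : coeff 0 b * coeff 0 c = 1 := by
    have := congrArg (coeff 0) hbc
    simpa using this.symm
  have hn : n ≤ N := by omega
  have hcf (m : ℕ) : φ (coeff m f) = if n ≤ m then coeff (m - n) b else 0 := by
    rw [← coeff_map, hf, coeff_mul_X_pow']
  have hcg (m : ℕ) : φ (coeff m g) = if k ≤ m then coeff (m - k) c else 0 := by
    rw [← coeff_map, hg, coeff_mul_X_pow']
  have hw (m : ℕ) (hm : m ∈ Finset.range (N + 1)) :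
      φ (orderWeight f g N m) = if m = n then 1 else 0 := by
    rw [Finset.mem_range] at hm
    rw [orderWeight, map_mul, hcf, hcg]
    split_ifs with h₁ h₂ h₃ h₃ <;> try first | omega | simp
    subst h₃
    rw [show N - m - k = 0 by omega, Nat.sub_self, hbc0]
  have hmem : n ∈ Finset.range (N + 1) := by simpa [Nat.lt_succ_iff] using hn
  have hv : map φ (weightedShift f g N) = b := by
    ext i
    rw [coeff_map, weightedShift, coeff_mk, map_sum,
      Finset.sum_congr rfl fun m hm => by rw [map_mul, hw m hm, ite_mul, one_mul, zero_mul],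
      Finset.sum_ite_eq' _ n, if_pos hmem, hcf, if_pos (by omega), Nat.add_sub_cancel]
  refine ⟨n, hn, ?_, ?_, ?_⟩
  · rw [hv, hf, mul_comm]
  · rw [hv]
    exact .of_mul_eq_one _ hbc.symm
  · rw [weightedMonomial, Polynomial.map_sum,
      Finset.sum_congr rfl fun m hm => by
        rw [Polynomial.map_mul, Polynomial.map_C, hw m hm, Polynomial.map_pow, Polynomial.map_X,
          apply_ite Polynomial.C, Polynomial.C_1, Polynomial.C_0, ite_mul, one_mul, zero_mul],
      Finset.sum_ite_eq' _ n, if_pos hmem]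

theorem isUnit_weightedShift {A : Type*} [CommRing A] {f g : PowerSeries A} {N : ℕ}
    (hfg : f * g = X ^ N) : IsUnit (weightedShift f g N) := by
  rw [isUnit_iff_constantCoeff]
  by_contra h
  obtain ⟨I, hI, hmem⟩ := exists_max_ideal_of_mem_nonunits (mem_nonunits_iff.mpr h)
  obtain ⟨n, -, -, hu, -⟩ :=
    exists_map_eq_X_pow_mul_weightedShift (Ideal.Quotient.mk I) hfg
  rw [isUnit_iff_constantCoeff, ← coeff_zero_eq_constantCoeff_apply, coeff_map,
    coeff_zero_eq_constantCoeff_apply] at hu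
  exact hu.ne_zero (Ideal.Quotient.eq_zero_iff_mem.mpr hmem)

end PowerSeries

theorem Polynomial.isUnit_toLaurent_of_forall_map_eq_X_pow {A : Type*} [CommRing A]
    {r : Polynomial A} {N : ℕ}
    (h : ∀ P : Ideal A, P.IsPrime → r.map (Ideal.Quotient.mk P) = Polynomial.X ^ N) :
    IsUnit (Polynomial.toLaurent r) := by
  have hnil : IsNilpotent (r - Polynomial.X ^ N) := by
    rw [Polynomial.isNilpotent_iff]
    intro i
    rw [nilpotent_iff_mem_prime]
    intro P hP
    rw [← Ideal.Quotient.eq_zero_iff_mem, ← Polynomial.coeff_map, Polynomial.map_sub, h P hP,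
      Polynomial.map_pow, Polynomial.map_X, sub_self, Polynomial.coeff_zero]
  have hX : IsUnit (Polynomial.toLaurent (Polynomial.X ^ N : Polynomial A)) := by
    rw [Polynomial.toLaurent_X_pow]
    exact LaurentPolynomial.isUnit_T _
  have := (hnil.map Polynomial.toLaurent).isUnit_add_left_of_commute hX (Commute.all _ _)
  rwa [← map_add, add_sub_cancel] at this

/-- A divisor of a power of `X` is, up to a unit, a polynomial invertible as a Laurent
polynomial. -/
theorem PowerSeries.exists_eq_coe_mul_unit_of_dvd_X_pow {A : Type*} [CommRing A]
    {f : PowerSeries A} {N : ℕ} (hf : f ∣ PowerSeries.X ^ N) :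
    ∃ (p : Polynomial A) (q : (PowerSeries A)ˣ),
      f = p * q ∧ IsUnit (Polynomial.toLaurent p) := by
  obtain ⟨g, hfg⟩ := hf
  replace hfg := hfg.symm
  obtain ⟨v, hv⟩ := isUnit_weightedShift hfg
  have hvv : (↑v⁻¹ : PowerSeries A) * v = 1 := v.inv_mul
  set w : PowerSeries A := f * ↑v⁻¹ with hw
  set h : PowerSeries A := mk fun i => coeff (i + (N + 1)) w
  have hwN : w * ((v : PowerSeries A) * g) = X ^ N := by
    rw [hw, ← hfg]
    linear_combination f * g * hvv
  have hsplit : w = X ^ (N + 1) * h + (w.trunc (N + 1) : PowerSeries A) :=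
    w.eq_X_pow_mul_shift_add_trunc (N + 1)
  have hs : IsUnit (1 - X * ((v : PowerSeries A) * g * h)) := by
    simp [isUnit_iff_constantCoeff]
  obtain ⟨s, hs⟩ := hs
  have htrunc : (w.trunc (N + 1) : PowerSeries A) = w * s := by
    rw [hs]
    linear_combination -hsplit + X * h * hwN
  refine ⟨w.trunc (N + 1), s⁻¹ * v, ?_, ?_⟩
  · rw [htrunc, hw, Units.val_mul]
    linear_combination -f * hvv - f * (↑v⁻¹ * (v : PowerSeries A)) * s.mul_inv
  · have hprod : IsUnit (Polynomial.toLaurent (w.trunc (N + 1) * weightedMonomial f g N)) := by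
      refine Polynomial.isUnit_toLaurent_of_forall_map_eq_X_pow (N := N) fun P hP => ?_
      obtain ⟨n, hn, hmap, -, hmon⟩ :=
        exists_map_eq_X_pow_mul_weightedShift (Ideal.Quotient.mk P) hfg
      have hwmap : map (Ideal.Quotient.mk P) w = X ^ n := by
        rw [hw, map_mul, hmap, ← hv, mul_assoc, ← map_mul, v.mul_inv, map_one, mul_one]
      have hp : (w.trunc (N + 1)).map (Ideal.Quotient.mk P) = Polynomial.X ^ n := by
        ext i
        rw [Polynomial.coeff_map, coeff_trunc, apply_ite (Ideal.Quotient.mk P), ← coeff_map, hwmap,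
          coeff_X_pow, Polynomial.coeff_X_pow, map_zero]
        split_ifs <;> first | rfl | omega
      rw [Polynomial.map_mul, hp, hmon, ← pow_add, Nat.add_sub_cancel' hn]
    rw [map_mul] at hprod
    exact isUnit_of_mul_isUnit_left hprod

theorem laurentInclusion_toLaurent {A : Type*} [CommRing A] (p : Polynomial A) :
    laurentInclusion A (Polynomial.toLaurent p) =
      algebraMap (PowerSeries A) (Localization.Away (PowerSeries.X : PowerSeries A)) p :=
  IsLocalization.Away.lift_eq (S := LaurentPolynomial A) (Polynomial.X : Polynomial A) _ p

/-- Every unit of the Laurent series ring `A((t))` factors as a Laurent polynomial unit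
times a power series unit (the case `G = 𝔾ₘ`). -/
theorem units_laurentSeries_factorization (A : Type*) [CommRing A]
    (u : (Localization.Away (PowerSeries.X : PowerSeries A))ˣ) :
    ∃ (p : (LaurentPolynomial A)ˣ) (q : (PowerSeries A)ˣ),
      u = Units.map (laurentInclusion A).toMonoidHom p *
          Units.map (algebraMap (PowerSeries A)
            (Localization.Away (PowerSeries.X : PowerSeries A))).toMonoidHom q := by
  obtain ⟨m, f, hf⟩ := IsLocalization.Away.surj (PowerSeries.X : PowerSeries A)
    (u : Localization.Away (PowerSeries.X : PowerSeries A))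
  have hfu : IsUnit (algebraMap (PowerSeries A)
      (Localization.Away (PowerSeries.X : PowerSeries A)) f) :=
    hf ▸ u.isUnit.mul (IsLocalization.Away.algebraMap_pow_isUnit PowerSeries.X m)
  obtain ⟨N, hN⟩ := (IsLocalization.Away.algebraMap_isUnit_iff PowerSeries.X).mp hfu
  obtain ⟨p, q, hpq, hp⟩ := PowerSeries.exists_eq_coe_mul_unit_of_dvd_X_pow hN
  obtain ⟨t, ht⟩ := LaurentPolynomial.isUnit_T (R := A) m
  refine ⟨hp.unit * t⁻¹, q, ?_⟩
  have htX : Units.map (laurentInclusion A).toMonoidHom t =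
      algebraMap (PowerSeries A) (Localization.Away (PowerSeries.X : PowerSeries A))
        PowerSeries.X ^ m := by
    change laurentInclusion A t = _
    rw [ht, ← Polynomial.toLaurent_X_pow, laurentInclusion_toLaurent, Polynomial.coe_pow,
      Polynomial.coe_X, map_pow]
  rw [map_mul, map_inv, mul_right_comm, eq_mul_inv_iff_mul_eq]
  ext
  rw [Units.val_mul, htX, hf, hpq, map_mul, ← laurentInclusion_toLaurent]
  rfl
end

section
/- Let A be a commutative ring and let M be a finitely generated projective module over the power series ring A⟦t⟧. If the base change M ⊗_{A⟦t⟧} A((t)) is a free A((t))-module, then M is a free A⟦t⟧-module. (Equivalently: every vector bundle on Spec A⟦t⟧ that trivializes over Spec A((t)) is trivial, i.e., for G = GL_n the affine Grassmannian Gr_G equals the presheaf quotient LG/L⁺G.) -/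
set_option synthInstance.maxHeartbeats 1000000
open TensorProduct

section Reachable

variable {A W ι : Type*} [CommRing A] [AddCommGroup W] [Module A W]

/-- A family in which every member is either an input `b l` or the image under `φ` of an earlier
member. -/
def IsKrylovFamily (φ : Module.End A W) (b : ι → W) {d : ℕ} (w : Fin d → W) : Prop :=
  ∀ i, (∃ l, w i = b l) ∨ ∃ j < i, w i = φ (w j)

/-- The pencil `(v, w) ↦ ∑ vₗ bₗ + (a - φ) w` of the pair `(φ, b)` at the scalar `a`. -/
def pencil [Fintype ι] (φ : Module.End A W) (b : ι → W) (a : A) : (ι → A) × W →ₗ[A] W :=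
  (Fintype.linearCombination A b).coprod (a • LinearMap.id - φ)

theorem IsKrylovFamily.snoc {φ : Module.End A W} {b : ι → W} {d : ℕ} {w : Fin d → W}
    (hw : IsKrylovFamily φ b w) {x : W} (hx : (∃ l, x = b l) ∨ ∃ j, x = φ (w j)) :
    IsKrylovFamily φ b (Fin.snoc w x : Fin (d + 1) → W) := by
  intro i
  induction i using Fin.lastCases with
  | last =>
    rcases hx with ⟨l, hl⟩ | ⟨j, hj⟩
    · exact .inl ⟨l, by simpa using hl⟩
    · exact .inr ⟨j.castSucc, Fin.castSucc_lt_last j, by simpa using hj⟩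
  | cast i =>
    rcases hw i with ⟨l, hl⟩ | ⟨j, hji, hj⟩
    · exact .inl ⟨l, by simpa using hl⟩
    · exact .inr ⟨j.castSucc, Fin.castSucc_lt_castSucc_iff.mpr hji, by simpa using hj⟩

/-- If the inputs `b` generate `W` under `φ`, a Krylov family lifts a basis of `W / mW`. -/
theorem exists_isKrylovFamily_linearIndependent [Module.Finite A W] (φ : Module.End A W)
    (b : ι → W)
    (hb : ∀ N : Submodule A W, (∀ l, b l ∈ N) → (∀ x ∈ N, φ x ∈ N) → N = ⊤)
    (m : Ideal A) [m.IsMaximal] :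
    ∃ (d : ℕ) (w : Fin d → W), IsKrylovFamily φ b w ∧
      LinearIndependent (A ⧸ m) (fun i ↦ (m • ⊤ : Submodule A W).mkQ (w i)) ∧
      Submodule.span A (Set.range w) ⊔ m • ⊤ = ⊤ := by
  let _ := Ideal.Quotient.field m
  by_contra! hcon
  have key : ∀ s : ℕ, ∃ w : Fin s → W, IsKrylovFamily φ b w ∧
      LinearIndependent (A ⧸ m) (fun i ↦ (m • ⊤ : Submodule A W).mkQ (w i)) := by
    intro s
    induction s with
    | zero => exact ⟨Fin.elim0, fun i ↦ i.elim0, linearIndependent_empty_type⟩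
    | succ s ih =>
      obtain ⟨w, hw, hli⟩ := ih
      have hne := hcon s w hw hli
      set N := Submodule.span A (Set.range w) ⊔ m • ⊤ with hN
      obtain ⟨x, hx, hxN⟩ : ∃ x, ((∃ l, x = b l) ∨ ∃ j, x = φ (w j)) ∧ x ∉ N := by
        by_contra! hall
        refine hne (hb N (fun l ↦ hall _ (.inl ⟨l, rfl⟩)) fun x hx ↦ ?_)
        have : N ≤ N.comap φ := by
          refine sup_le (Submodule.span_le.mpr ?_) ?_
          · rintro _ ⟨j, rfl⟩
            exact hall _ (.inr ⟨j, rfl⟩)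
          · rw [← Submodule.map_le_iff_le_comap, Submodule.map_smul'']
            exact (Submodule.smul_mono le_rfl le_top).trans le_sup_right
        exact this hx
      refine ⟨Fin.snoc w x, hw.snoc hx, ?_⟩
      have hsnoc : (fun i ↦ (m • ⊤ : Submodule A W).mkQ ((Fin.snoc w x : Fin (s + 1) → W) i)) =
          Fin.snoc (fun i ↦ (m • ⊤ : Submodule A W).mkQ (w i))
            ((m • ⊤ : Submodule A W).mkQ x) := by
        ext i
        induction i using Fin.lastCases <;> simp
      rw [hsnoc, linearIndependent_finSnoc]
      refine ⟨hli, fun hmem ↦ hxN ?_⟩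
      rw [← Submodule.restrictScalars_mem A, Submodule.restrictScalars_span A (A ⧸ m)
        Ideal.Quotient.mk_surjective] at hmem
      have hr : Set.range (fun i ↦ (m • ⊤ : Submodule A W).mkQ (w i)) =
          (m • ⊤ : Submodule A W).mkQ '' Set.range w := by
        rw [← Set.range_comp]; rfl
      rw [hr, ← Submodule.map_span, ← Submodule.mem_comap, Submodule.comap_map_mkQ,
        sup_comm] at hmem
      exact hmem
  obtain ⟨w, -, hli⟩ := key (Module.finrank (A ⧸ m) (W ⧸ (m • ⊤ : Submodule A W)) + 1)
  have : Module.Finite (A ⧸ m) (W ⧸ (m • ⊤ : Submodule A W)) :=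
    Module.Finite.of_restrictScalars_finite A _ _
  simpa using hli.fintype_card_le_finrank

/-- A lift of a basis of `W / mW` becomes a basis after inverting some `c ∉ m`. -/
theorem exists_linearCombination_inverse_smul [Module.Finite A W] [Module.Projective A W]
    (m : Ideal A) [m.IsMaximal] {d : ℕ} (w : Fin d → W)
    (hli : LinearIndependent (A ⧸ m) (fun i ↦ (m • ⊤ : Submodule A W).mkQ (w i)))
    (hsp : Submodule.span A (Set.range w) ⊔ m • ⊤ = ⊤) :
    ∃ c ∉ m, ∃ ψ : W →ₗ[A] (Fin d → A),
      (∀ x, Fintype.linearCombination A w (ψ x) = c • x) ∧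
      ∀ v, ψ (Fintype.linearCombination A w v) = c • v := by
  classical
  set β := Fintype.linearCombination A w with hβ
  let _ := Ideal.Quotient.field m
  set π := (m • ⊤ : Submodule A W).mkQ
  obtain ⟨r, hr⟩ := LinearMap.exists_leftInverse_of_injective
    (Fintype.linearCombination (A ⧸ m) (fun i ↦ π (w i)))
    (LinearMap.ker_eq_bot.mpr (hli.fintypeLinearCombination_injective))
  let q : (Fin d → A) →ₗ[A] (Fin d → A ⧸ m) :=
    LinearMap.pi fun i ↦ (Algebra.linearMap A (A ⧸ m)).comp (LinearMap.proj i)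
  have hq : Function.Surjective q := fun y ↦ by
    choose z hz using fun i ↦ Ideal.Quotient.mk_surjective (y i)
    exact ⟨z, funext hz⟩
  obtain ⟨ψ₀, hψ₀⟩ := Module.projective_lifting_property q ((r.restrictScalars A).comp π) hq
  let G : Matrix (Fin d) (Fin d) A := LinearMap.toMatrix' (ψ₀.comp β)
  have hG : G.map (Ideal.Quotient.mk m) = 1 := by
    ext i j
    have h1 : q (ψ₀ (w j)) = r (π (w j)) := LinearMap.congr_fun hψ₀ (w j)
    have h2 := LinearMap.congr_fun hr (Pi.single j 1)
    simp only [LinearMap.comp_apply, Fintype.linearCombination_apply_single, one_smul,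
      LinearMap.id_apply] at h2
    have h3 := congrFun (h1.trans h2) i
    simp only [G, Matrix.map_apply, LinearMap.toMatrix'_apply, LinearMap.comp_apply, hβ]
    have h4 : (Fintype.linearCombination A w) (Pi.single j 1) = w j := by simp
    rw [h4, Matrix.one_apply]
    rw [Pi.single_apply] at h3
    exact h3
  have hdet : G.det ∉ m := by
    rw [← Ideal.Quotient.eq_zero_iff_mem, RingHom.map_det, RingHom.mapMatrix_apply, hG]
    simp
  obtain ⟨c₁, hc₁, hle⟩ := Submodule.exists_sub_one_mem_and_smul_le_of_fg_of_le_sup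
    (N := LinearMap.range β) (N' := ⊤) (P := ⊤) (I := m) Module.Finite.fg_top le_rfl (by
      rw [hβ, Fintype.range_linearCombination, hsp])
  have hc₁m : c₁ ∉ m := fun h ↦ (Ideal.ne_top_iff_one m).mp (Ideal.IsMaximal.ne_top ‹_›)
    (by simpa using m.sub_mem h hc₁)
  let ψ₁ : W →ₗ[A] (Fin d → A) := (Matrix.toLin' G.adjugate).comp ψ₀
  have hψ₁ : ∀ v, ψ₁ (β v) = G.det • v := by
    intro v
    have h1 : ψ₀ (β v) = G.mulVec v := by
      rw [← Matrix.toLin'_apply, Matrix.toLin'_toMatrix']; rfl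
    simp only [ψ₁, LinearMap.comp_apply, h1, Matrix.toLin'_apply, Matrix.mulVec_mulVec,
      Matrix.adjugate_mul, Matrix.smul_mulVec, Matrix.one_mulVec]
  refine ⟨c₁ * G.det, fun h ↦ ((Ideal.IsMaximal.isPrime ‹_›).mem_or_mem h).elim hc₁m hdet,
    c₁ • ψ₁, fun x ↦ ?_, fun v ↦ by rw [LinearMap.smul_apply, hψ₁, mul_smul]⟩
  obtain ⟨y, hy⟩ : c₁ • x ∈ LinearMap.range β :=
    hle (Submodule.smul_mem_pointwise_smul x c₁ ⊤ trivial)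
  rw [LinearMap.smul_apply, ← map_smul ψ₁, ← hy, hψ₁, map_smul, hy, smul_smul, mul_comm]

/-- A linear endomorphism of `Aᵈ` with strictly triangular matrix is nilpotent. -/
theorem linearCombination_pow_eq_zero_of_strictTriangular {d : ℕ} (lam : Fin d → Fin d → A)
    (h : ∀ i j, i ≤ j → lam i j = 0) :
    (Fintype.linearCombination A lam : Module.End A (Fin d → A)) ^ d = 0 := by
  have key : ∀ (k : ℕ) (x : Fin d → A) (j : Fin d), d ≤ j + k →
      ((Fintype.linearCombination A lam : Module.End A (Fin d → A)) ^ k) x j = 0 := by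
    intro k
    induction k with
    | zero => intro x j hj; have := j.2; omega
    | succ k ih =>
      intro x j hj
      rw [pow_succ', Module.End.mul_apply, Fintype.linearCombination_apply, Finset.sum_apply]
      refine Finset.sum_eq_zero fun i _ ↦ ?_
      rcases le_or_gt i j with hij | hij
      · simp [h i j hij]
      · have : (j : ℕ) < i := hij
        simp [ih x i (by omega)]
  ext i j
  simp [key d _ j (by omega)]

variable [Fintype ι]

/-- Along a Krylov family, the pencil has a right inverse whose second component is nilpotent. -/
theorem IsKrylovFamily.exists_pencil_eq_smul {φ : Module.End A W} {b : ι → W} {d : ℕ}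
    {w : Fin d → W} (hw : IsKrylovFamily φ b w) {c : A} (ψ : W →ₗ[A] (Fin d → A))
    (hβψ : ∀ x, Fintype.linearCombination A w (ψ x) = c • x)
    (hψβ : ∀ v, ψ (Fintype.linearCombination A w v) = c • v) (a : A) :
    ∃ (K : W →ₗ[A] (ι → A)) (L : Module.End A W), IsNilpotent L ∧
      ∀ x, pencil φ b a (K x, L x) = c • x := by
  classical
  set β := Fintype.linearCombination A w with hβ
  have step : ∀ i : Fin d, ∃ (κ : ι → A) (lam : Fin d → A), (∀ j, i ≤ j → lam j = 0) ∧
      pencil φ b a (κ, β lam) = w i := by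
    intro i
    induction i using WellFoundedLT.induction with
    | _ i ih =>
      rcases hw i with ⟨l, hl⟩ | ⟨j, hji, hj⟩
      · exact ⟨Pi.single l 1, 0, fun _ _ ↦ rfl, by simp [pencil, hl]⟩
      · obtain ⟨κ, lam, hlam, hpen⟩ := ih j hji
        refine ⟨a • κ, a • lam - Pi.single j 1, fun j' hj' ↦ ?_, ?_⟩
        · have hjj' : j < j' := hji.trans_le hj'
          simp [hlam j' hjj'.le, hjj'.ne']
        · have : (a • κ, β (a • lam - Pi.single j 1)) = a • (κ, β lam) - (0, w j) := by
            simp [hβ]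
          rw [this, map_sub, map_smul, hpen, hj]
          simp [pencil]
  choose κ lam hlam hpen using step
  let N : Module.End A (Fin d → A) := Fintype.linearCombination A lam
  have hN : N ^ d = 0 := linearCombination_pow_eq_zero_of_strictTriangular lam hlam
  refine ⟨(Fintype.linearCombination A κ).comp ψ, (β.comp N).comp ψ, ⟨d + 1, ?_⟩, fun x ↦ ?_⟩
  · have : ∀ k x, ((((β.comp N).comp ψ : Module.End A W)) ^ (k + 1)) x =
        c ^ k • β ((N ^ (k + 1)) (ψ x)) := by
      intro k
      induction k with
      | zero => intro x; simp
      | succ k ih =>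
        intro x
        rw [pow_succ', Module.End.mul_apply, ih, pow_succ' N (k + 1), Module.End.mul_apply]
        simp only [LinearMap.comp_apply, map_smul, hψβ, smul_smul, ← pow_succ]
    ext x
    rw [this, pow_succ, Module.End.mul_apply, hN]
    simp
  · have : (pencil φ b a).comp ((Fintype.linearCombination A κ).prod (β.comp N)) = β := by
      refine LinearMap.pi_ext' fun i ↦ LinearMap.ext_ring ?_
      simpa [N, hβ] using hpen i
    rw [← hβψ x]
    exact LinearMap.congr_fun this (ψ x)

theorem nonempty_ker_pencil_equiv {φ : Module.End A W} {b : ι → W} {a c : A}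
    {K : W →ₗ[A] (ι → A)} {L : Module.End A W} (hL : IsNilpotent L)
    (hKL : ∀ x, pencil φ b a (K x, L x) = c • x) (y : A) :
    Nonempty (LinearMap.ker (pencil φ b (a + c * y)) ≃ₗ[A] LinearMap.ker (pencil φ b a)) := by
  have hu : IsUnit (1 + y • L) := (hL.smul y).isUnit_one_add
  obtain ⟨u, hu⟩ := hu
  let e : W ≃ₗ[A] W := LinearMap.GeneralLinearGroup.generalLinearEquiv A W u
  have he : ∀ x, e x = x + y • L x := fun x ↦ by
    change (u : Module.End A W) x = _
    simp [hu]
  let g : ((ι → A) × W) ≃ₗ[A] ((ι → A) × W) :=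
    (LinearEquiv.refl A (ι → A)).skewProd e 0
  let g' : ((ι → A) × W) ≃ₗ[A] ((ι → A) × W) := LinearEquiv.ofLinearMap
    (LinearMap.id + (LinearMap.inl A (ι → A) W).comp ((y • K).comp (LinearMap.snd A (ι → A) W)))
    (LinearMap.id - (LinearMap.inl A (ι → A) W).comp ((y • K).comp (LinearMap.snd A (ι → A) W)))
    (by ext <;> simp) (by ext <;> simp)
  have hcomp : pencil φ b (a + c * y) = (pencil φ b a).comp (g'.trans g).toLinearMap := by
    refine LinearMap.ext fun p ↦ ?_
    obtain ⟨v, x⟩ := p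
    have h1 : (g'.trans g) (v, x) = (v, x) + y • (K x, L x) := by
      simp [g, g', he]
    rw [LinearMap.comp_apply, LinearEquiv.coe_coe, h1, map_add, map_smul, hKL]
    simp [pencil, add_smul, smul_smul, mul_comm c y]
    abel
  rw [hcomp, LinearMap.ker_comp]
  exact ⟨(g'.trans g).ofSubmodule' _⟩

/-- The kernel of the pencil of a reachable pair does not depend on the scalar. -/
theorem nonempty_ker_pencil_equiv_of_reachable [Module.Finite A W] [Module.Projective A W]
    (φ : Module.End A W) (b : ι → W)
    (hb : ∀ N : Submodule A W, (∀ l, b l ∈ N) → (∀ x ∈ N, φ x ∈ N) → N = ⊤) (a a' : A) :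
    Nonempty (LinearMap.ker (pencil φ b a) ≃ₗ[A] LinearMap.ker (pencil φ b a')) := by
  let J : Ideal A :=
    { carrier := {c | ∀ a y : A, Nonempty
        (LinearMap.ker (pencil φ b (a + c * y)) ≃ₗ[A] LinearMap.ker (pencil φ b a))}
      zero_mem' := fun a y ↦ by
        rw [zero_mul, add_zero]
        exact ⟨LinearEquiv.refl _ _⟩
      add_mem' := fun {c c'} hc hc' a y ↦ by
        obtain ⟨e⟩ := hc a y
        obtain ⟨e'⟩ := hc' (a + c * y) y
        rw [add_mul, ← add_assoc]
        exact ⟨e'.trans e⟩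
      smul_mem' := fun r c hc a y ↦ by
        rw [smul_eq_mul, mul_comm r c, mul_assoc]
        exact hc a (r * y) }
  have hJ : J = ⊤ := by
    by_contra hne
    obtain ⟨m, hm, hJm⟩ := J.exists_le_maximal hne
    obtain ⟨d, w, hw, hli, hsp⟩ := exists_isKrylovFamily_linearIndependent φ b hb m
    obtain ⟨c, hcm, ψ, hβψ, hψβ⟩ := exists_linearCombination_inverse_smul m w hli hsp
    refine hcm (hJm fun a y ↦ ?_)
    obtain ⟨K, L, hL, hKL⟩ := hw.exists_pencil_eq_smul ψ hβψ hψβ a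
    exact nonempty_ker_pencil_equiv hL hKL y
  have h1 : (1 : A) ∈ J := hJ ▸ trivial
  have h2 := h1 a' (a - a')
  rwa [one_mul, add_sub_cancel] at h2

theorem nonempty_ker_pencil_equiv_pi_of_isUnit (φ : Module.End A W) (b : ι → W) (a : A)
    (h : IsUnit (a • LinearMap.id - φ)) :
    Nonempty (LinearMap.ker (pencil φ b a) ≃ₗ[A] (ι → A)) := by
  have hbij := (Module.End.isUnit_iff _).mp h
  refine ⟨LinearEquiv.ofBijective
    ((LinearMap.fst A (ι → A) W).comp (LinearMap.ker (pencil φ b a)).subtype) ⟨?_, fun v ↦ ?_⟩⟩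
  · rw [injective_iff_map_eq_zero]
    rintro ⟨⟨v, x⟩, hx⟩ hv
    obtain rfl : v = 0 := hv
    have : x = 0 := hbij.1 (by simpa [pencil] using hx)
    subst this
    rfl
  · obtain ⟨x, hx⟩ := hbij.2 (-Fintype.linearCombination A b v)
    exact ⟨⟨(v, x), by rw [LinearMap.mem_ker, pencil, LinearMap.coprod_apply, hx,
      add_neg_cancel]⟩, rfl⟩

end Reachable
section PowerSeriesModule

open PowerSeries

variable {A M ι : Type*} [CommRing A] [AddCommGroup M] [Module A⟦X⟧ M]

theorem PowerSeries.smul_eq_X_smul_add [Module A M] [IsScalarTower A A⟦X⟧ M] (r : A⟦X⟧) (x : M) :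
    ∃ y : M, r • x = (X : A⟦X⟧) • y + constantCoeff r • x := by
  refine ⟨(PowerSeries.mk fun p ↦ coeff (p + 1) r) • x, ?_⟩
  conv_lhs => rw [eq_X_mul_shift_add_const r]
  rw [add_smul, mul_smul, ← algebraMap_smul A⟦X⟧ (constantCoeff r) x]
  rfl

theorem PowerSeries.isSMulRegular_X [Module.Projective A⟦X⟧ M] :
    IsSMulRegular M (X : A⟦X⟧) :=
  Module.Flat.isSMulRegular_of_isRegular
    (isLeftRegular_iff_isRegular.mp fun _ _ ↦ X_mul_cancel)

theorem PowerSeries.X_mem_jacobson_bot : (X : A⟦X⟧) ∈ (⊥ : Ideal A⟦X⟧).jacobson := by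
  rw [Ideal.mem_jacobson_bot]
  intro y
  rw [isUnit_iff_constantCoeff]
  simp

/-- An `X`-torsion-free finite `A⟦X⟧`-module whose reduction modulo `X` is free is free. -/
theorem free_of_surjective_of_ker_eq_X_smul [Module A M] [IsScalarTower A A⟦X⟧ M]
    [Fintype ι] [Module.Finite A⟦X⟧ M] (hX : IsSMulRegular M (X : A⟦X⟧))
    (p : M →ₗ[A] (ι → A)) (hp : Function.Surjective p)
    (hker : ∀ x, p x = 0 ↔ ∃ y, x = (X : A⟦X⟧) • y) : Module.Free A⟦X⟧ M := by
  classical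
  choose e he using fun i ↦ hp (Pi.single i 1)
  have hsum : ∀ r : ι → A⟦X⟧, p (∑ i, r i • e i) = fun i ↦ constantCoeff (r i) := by
    intro r
    have h1 : ∀ i, p (r i • e i) = constantCoeff (r i) • Pi.single i 1 := fun i ↦ by
      obtain ⟨y, hy⟩ := smul_eq_X_smul_add (r i) (e i)
      rw [hy, map_add, (hker _).mpr ⟨y, rfl⟩, zero_add, map_smul, he]
    rw [map_sum]
    simp_rw [h1]
    ext j
    simp [Pi.single_apply]
  have hli : LinearIndependent A⟦X⟧ e := by
    rw [Fintype.linearIndependent_iff]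
    have key : ∀ (n : ℕ) (r : ι → A⟦X⟧), ∑ i, r i • e i = 0 → ∀ i, X ^ n ∣ r i := by
      intro n
      induction n with
      | zero => simp
      | succ n ih =>
        intro r hr
        have h0 : ∀ i, X ∣ r i := fun i ↦ by
          rw [X_dvd_iff, ← congrFun (hsum r) i, hr, map_zero]
          rfl
        choose q hq using h0
        have hq0 : ∑ i, q i • e i = 0 := hX.right_eq_zero_of_smul (by
          rw [Finset.smul_sum, ← hr]
          simp_rw [hq, mul_smul])
        intro i
        rw [hq i, pow_succ']
        exact mul_dvd_mul_left _ (ih q hq0 i)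
    intro r hr i
    ext n
    exact (X_pow_dvd_iff.mp (key (n + 1) r hr i)) n n.lt_succ_self
  have hsp : ⊤ ≤ Submodule.span A⟦X⟧ (Set.range e) := by
    refine Submodule.le_of_le_smul_of_le_jacobson_bot (I := Ideal.span {(X : A⟦X⟧)})
      Module.Finite.fg_top
      ((Ideal.span_singleton_le_iff_mem _).mpr X_mem_jacobson_bot) fun x _ ↦ ?_
    have h0 : p (x - ∑ i, C (p x i) • e i) = 0 := by
      rw [map_sub, hsum]
      ext i
      simp
    obtain ⟨y, hy⟩ := (hker _).mp h0
    rw [← sub_add_cancel x (∑ i, C (p x i) • e i), add_comm, hy]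
    exact Submodule.add_mem_sup
      (Submodule.sum_mem _ fun i _ ↦ Submodule.smul_mem _ _ (Submodule.subset_span ⟨i, rfl⟩))
      (Submodule.smul_mem_smul (Ideal.mem_span_singleton_self _) trivial)
  exact Module.Free.of_basis (Module.Basis.mk hli hsp)

/-- Division by `X ^ K` on power series, discarding the terms of degree below `K`. -/
noncomputable def PowerSeries.divXPow (K : ℕ) : A⟦X⟧ →ₗ[A] A⟦X⟧ where
  toFun r := PowerSeries.mk fun i ↦ coeff (i + K) r
  map_add' _ _ := by ext; simp
  map_smul' _ _ := by ext; simp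

/-- The polynomial of degree below `K` with given coefficients, as a power series. -/
noncomputable def PowerSeries.ofFinCoeff (K : ℕ) : (Fin K → A) →ₗ[A] A⟦X⟧ :=
  ∑ j : Fin K, (PowerSeries.monomial (j : ℕ)).comp (LinearMap.proj j)

/-- The coefficients of degree below `K` of a power series. -/
noncomputable def PowerSeries.finCoeff (K : ℕ) : A⟦X⟧ →ₗ[A] (Fin K → A) :=
  LinearMap.pi fun j ↦ PowerSeries.coeff (j : ℕ)

theorem PowerSeries.divXPow_X_pow_mul (K : ℕ) (r : A⟦X⟧) :
    divXPow K (X ^ K * r) = r := by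
  ext n
  simp [divXPow, coeff_X_pow_mul]

theorem PowerSeries.finCoeff_X_pow_mul (K : ℕ) (r : A⟦X⟧) :
    finCoeff K (X ^ K * r) = 0 := by
  ext j
  simp [finCoeff, coeff_X_pow_mul', j.2]

theorem PowerSeries.ofFinCoeff_finCoeff (K : ℕ) (r : A⟦X⟧) :
    ofFinCoeff K (finCoeff K r) + X ^ K * divXPow K r = r := by
  ext n
  have h1 : coeff n (ofFinCoeff K (finCoeff K r)) = if n < K then coeff n r else 0 := by
    simp only [ofFinCoeff, finCoeff, LinearMap.sum_apply, map_sum, LinearMap.comp_apply,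
      LinearMap.proj_apply, LinearMap.pi_apply, coeff_monomial]
    rw [Fin.sum_univ_eq_sum_range (fun j ↦ if n = j then coeff j r else 0) K]
    simp
  rw [map_add, h1, coeff_X_pow_mul']
  by_cases hn : n < K
  · simp [hn, not_le.mpr hn]
  · simp [hn, not_lt.mp hn, divXPow]

/-- The cokernel of a full lattice in `A⟦X⟧ⁿ` is finite projective over `A`. -/
theorem finite_projective_quotient_range [Finite ι] [Module.Finite A⟦X⟧ M]
    [Module.Projective A⟦X⟧ M]
    (f : M →ₗ[A⟦X⟧] (ι → A⟦X⟧)) (g : (ι → A⟦X⟧) →ₗ[A⟦X⟧] M) (K : ℕ)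
    (hfg : ∀ v, f (g v) = (X : A⟦X⟧) ^ K • v) (hgf : ∀ x, g (f x) = (X : A⟦X⟧) ^ K • x) :
    Module.Finite A ((ι → A⟦X⟧) ⧸ LinearMap.range f) ∧
      Module.Projective A ((ι → A⟦X⟧) ⧸ LinearMap.range f) := by
  obtain ⟨n, q, s, -, -, hqs⟩ := Module.Finite.exists_comp_eq_id_of_projective A⟦X⟧ M
  let i₀ : (ι → A⟦X⟧) →ₗ[A] (Fin n → Fin K → A) :=
    ((finCoeff (A := A) K).compLeft (Fin n)).comp ((s.comp g).restrictScalars A)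
  have hi₀ : (LinearMap.range f).restrictScalars A ≤ LinearMap.ker i₀ := by
    rintro _ ⟨x, rfl⟩
    rw [LinearMap.mem_ker]
    ext j : 1
    simp only [i₀, LinearMap.comp_apply, LinearMap.restrictScalars_apply, hgf, map_smul]
    exact finCoeff_X_pow_mul K (s x j)
  let i : ((ι → A⟦X⟧) ⧸ LinearMap.range f) →ₗ[A] (Fin n → Fin K → A) :=
    ((LinearMap.range f).restrictScalars A).liftQ i₀ hi₀
  let t : (Fin n → Fin K → A) →ₗ[A] ((ι → A⟦X⟧) ⧸ LinearMap.range f) :=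
    ((LinearMap.range f).mkQ.restrictScalars A).comp
      (((divXPow (A := A) K).compLeft ι).comp
        (((f.comp q).restrictScalars A).comp ((ofFinCoeff (A := A) K).compLeft (Fin n))))
  have hti : t.comp i = LinearMap.id := by
    refine LinearMap.ext fun y ↦ ?_
    obtain ⟨v, rfl⟩ := Submodule.Quotient.mk_surjective _ y
    let z : Fin n → A⟦X⟧ := fun j ↦ divXPow K (s (g v) j)
    have h1 : (ofFinCoeff (A := A) K).compLeft (Fin n) (i₀ v) =
        s (g v) - (X : A⟦X⟧) ^ K • z := by
      ext1 j
      exact eq_sub_of_add_eq (ofFinCoeff_finCoeff K (s (g v) j))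
    have h2 : f (q (s (g v) - (X : A⟦X⟧) ^ K • z)) = (X : A⟦X⟧) ^ K • (v - f (q z)) := by
      have h3 : q (s (g v)) = g v := LinearMap.congr_fun hqs (g v)
      rw [map_sub, h3, map_smul, map_sub, hfg, map_smul, smul_sub]
    have h4 : (divXPow (A := A) K).compLeft ι ((X : A⟦X⟧) ^ K • (v - f (q z))) =
        v - f (q z) := by
      ext1 j
      exact divXPow_X_pow_mul K _
    change (LinearMap.range f).mkQ ((divXPow (A := A) K).compLeft ι (f (q
      ((ofFinCoeff (A := A) K).compLeft (Fin n) (i₀ v))))) = (LinearMap.range f).mkQ v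
    rw [h1, h2, h4, map_sub, sub_eq_self]
    exact (Submodule.Quotient.mk_eq_zero _).mpr ⟨_, rfl⟩
  exact ⟨Module.Finite.of_surjective t fun y ↦ ⟨i y, LinearMap.congr_fun hti y⟩,
    Module.Projective.of_split i t hti⟩

/-- A full lattice in `A⟦X⟧ⁿ` is free. -/
theorem free_of_comp_eq_X_pow_smul [Finite ι] [Module.Finite A⟦X⟧ M]
    [Module.Projective A⟦X⟧ M]
    (f : M →ₗ[A⟦X⟧] (ι → A⟦X⟧)) (g : (ι → A⟦X⟧) →ₗ[A⟦X⟧] M) (K : ℕ)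
    (hfg : ∀ v, f (g v) = (X : A⟦X⟧) ^ K • v) (hgf : ∀ x, g (f x) = (X : A⟦X⟧) ^ K • x) :
    Module.Free A⟦X⟧ M := by
  classical
  have _ := Fintype.ofFinite ι
  let _ : Module A M := Module.compHom M (algebraMap A A⟦X⟧)
  have _ : IsScalarTower A A⟦X⟧ M := IsScalarTower.of_algebraMap_smul fun _ _ ↦ rfl
  obtain ⟨_, _⟩ := finite_projective_quotient_range f g K hfg hgf
  let W := (ι → A⟦X⟧) ⧸ LinearMap.range f
  let π : (ι → A⟦X⟧) →ₗ[A⟦X⟧] W := (LinearMap.range f).mkQ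
  have hπ : ∀ v, π v = 0 ↔ ∃ x, f x = v := fun v ↦ Submodule.Quotient.mk_eq_zero _
  have hπs : Function.Surjective π := Submodule.mkQ_surjective _
  have hπX : ∀ v, π ((X : A⟦X⟧) ^ K • v) = 0 := fun v ↦ (hπ _).mpr ⟨g v, hfg v⟩
  let φ : Module.End A W := Algebra.lsmul A A W (X : A⟦X⟧)
  have hφ : ∀ v, φ (π v) = π ((X : A⟦X⟧) • v) := fun v ↦ (map_smul π _ v).symm
  have hφpow : ∀ k v, (φ ^ k) (π v) = π ((X : A⟦X⟧) ^ k • v) := by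
    intro k
    induction k with
    | zero => simp
    | succ k ih =>
      intro v
      rw [pow_succ', Module.End.mul_apply, ih, hφ, smul_smul, pow_succ']
  have hnil : IsNilpotent φ := ⟨K, LinearMap.ext fun y ↦ by
    obtain ⟨v, rfl⟩ := hπs y
    rw [hφpow, hπX, LinearMap.zero_apply]⟩
  let b : ι → W := fun i ↦ π (Pi.single i 1)
  let const : (ι → A) →ₗ[A] (ι → A⟦X⟧) := (Algebra.linearMap A A⟦X⟧).compLeft ι
  have hconst : ∀ a, Fintype.linearCombination A b a = π (const a) := by
    intro a
    have : (Fintype.linearCombination A b) = (π.restrictScalars A).comp const := by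
      refine LinearMap.pi_ext' fun i ↦ LinearMap.ext_ring ?_
      have : const (Pi.single i 1) = Pi.single i 1 := by
        ext1 j
        rcases eq_or_ne j i with rfl | hji
        · simp [const]
        · simp [const, hji]
      simp [this, b]
    rw [this]; rfl
  have hb : ∀ N : Submodule A W, (∀ l, b l ∈ N) → (∀ x ∈ N, φ x ∈ N) → N = ⊤ := by
    intro N hbN hφN
    have hcN : ∀ k a, π ((X : A⟦X⟧) ^ k • const a) ∈ N := by
      intro k a
      induction k with
      | zero =>
        rw [pow_zero, one_smul, ← hconst, Fintype.linearCombination_apply]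
        exact N.sum_mem fun l _ ↦ N.smul_mem _ (hbN l)
      | succ k ih =>
        rw [pow_succ', mul_smul, ← hφ]
        exact hφN _ ih
    have hN : ∀ k v, (∀ v, π ((X : A⟦X⟧) ^ k • v) ∈ N) → π v ∈ N := by
      intro k
      induction k with
      | zero => intro v h; simpa using h v
      | succ k ih =>
        refine fun v h ↦ ih v fun v ↦ ?_
        have hv : v = (X : A⟦X⟧) • (fun i ↦ divXPow 1 (v i)) +
            const (fun i ↦ constantCoeff (v i)) := by
          ext1 i
          exact eq_X_mul_shift_add_const (v i)
        rw [hv, smul_add, map_add, smul_smul, ← pow_succ]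
        exact N.add_mem (h _) (hcN _ _)
    rw [eq_top_iff]
    intro y _
    obtain ⟨v, rfl⟩ := hπs y
    exact hN K v fun v ↦ by rw [hπX]; exact N.zero_mem
  obtain ⟨e₁⟩ := nonempty_ker_pencil_equiv_of_reachable φ b hb 0 1
  obtain ⟨e₂⟩ := nonempty_ker_pencil_equiv_pi_of_isUnit φ b 1
    (by rw [one_smul]; exact hnil.isUnit_one_sub)
  let c₀ : (ι → A⟦X⟧) →ₗ[A] (ι → A) := (PowerSeries.coeff (R := A) 0).compLeft ι
  let sh : (ι → A⟦X⟧) →ₗ[A] (ι → A⟦X⟧) := (divXPow (A := A) 1).compLeft ι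
  have hsplit : ∀ v, v = (X : A⟦X⟧) • sh v + const (c₀ v) := fun v ↦ by
    ext1 i
    have hi := eq_X_mul_shift_add_const (v i)
    rwa [← coeff_zero_eq_constantCoeff_apply] at hi
  have hc₀ : ∀ (v : ι → A⟦X⟧) a, c₀ ((X : A⟦X⟧) • v + const a) = a := fun v a ↦ by
    ext i; simp [c₀, const]
  have hsh : ∀ (v : ι → A⟦X⟧) a, sh ((X : A⟦X⟧) • v + const a) = v := fun v a ↦ by
    ext i n
    simp [sh, const, divXPow, coeff_succ_X_mul]
  let p₀ : M →ₗ[A] (ι → A) × W :=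
    (c₀.prod (-((π.restrictScalars A).comp sh))).comp (f.restrictScalars A)
  have hpen : ∀ (a : ι → A) (v : ι → A⟦X⟧), pencil φ b 0 (a, π v) =
      π (const a - (X : A⟦X⟧) • v) := by
    intro a v
    simp [pencil, hconst, hφ, sub_eq_add_neg]
  let p : M →ₗ[A] LinearMap.ker (pencil φ b 0) := p₀.codRestrict _ fun x ↦ by
    have : p₀ x = (c₀ (f x), π (-sh (f x))) := by simp [p₀]
    rw [LinearMap.mem_ker, this, hpen, smul_neg, sub_neg_eq_add, add_comm, ← hsplit]
    exact (hπ _).mpr ⟨x, rfl⟩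
  have hfinj : ∀ x, f x = 0 → x = 0 := by
    intro x hx
    exact (isSMulRegular_X.pow K).right_eq_zero_of_smul (by rw [← hgf, hx, map_zero])
  refine free_of_surjective_of_ker_eq_X_smul isSMulRegular_X ((e₁.trans e₂).toLinearMap.comp p)
    ((e₁.trans e₂).surjective.comp ?_) fun x ↦ ?_
  · rintro ⟨⟨a, y⟩, hy⟩
    obtain ⟨v, rfl⟩ := hπs y
    rw [LinearMap.mem_ker, hpen, hπ] at hy
    obtain ⟨x, hx⟩ := hy
    refine ⟨x, Subtype.ext ?_⟩
    have hx' : f x = (X : A⟦X⟧) • (-v) + const a := by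
      rw [hx, smul_neg]; abel
    change (c₀ (f x), -π (sh (f x))) = _
    rw [hx', hc₀, hsh, map_neg, neg_neg]
  · rw [LinearMap.comp_apply, LinearEquiv.coe_coe, LinearEquiv.map_eq_zero_iff, Subtype.ext_iff]
    change ((c₀ (f x), -π (sh (f x))) = (0 : (ι → A) × W)) ↔ _
    rw [Prod.mk_eq_zero, neg_eq_zero, hπ]
    constructor
    · rintro ⟨h1, y, hy⟩
      refine ⟨y, sub_eq_zero.mp (hfinj _ ?_)⟩
      rw [map_sub, map_smul, hy, sub_eq_zero]
      conv_lhs => rw [hsplit (f x), h1, map_zero, add_zero]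
    · rintro ⟨y, rfl⟩
      have h1 := hc₀ (f y) 0
      have h2 := hsh (f y) 0
      rw [map_zero, add_zero] at h1 h2
      rw [map_smul]
      exact ⟨h1, y, h2.symm⟩

theorem PowerSeries.injective_of_isLocalizedModule_powers_X {N : Type*} [AddCommGroup N]
    [Module A⟦X⟧ N] [Module.Projective A⟦X⟧ M] (f : M →ₗ[A⟦X⟧] N)
    [IsLocalizedModule (Submonoid.powers (X : A⟦X⟧)) f] : Function.Injective f := by
  rw [IsLocalizedModule.injective_iff_isRegular (Submonoid.powers (X : A⟦X⟧))]
  rintro ⟨_, n, rfl⟩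
  exact isSMulRegular_X.pow n

/-- A finite projective `A⟦X⟧`-module isomorphic to a finite free module after inverting `X` is
itself free. -/
theorem free_of_isLocalizedModule_powers_X [Finite ι] [Module.Finite A⟦X⟧ M]
    [Module.Projective A⟦X⟧ M] {N L : Type*} [AddCommGroup N] [Module A⟦X⟧ N]
    [AddCommGroup L] [Module A⟦X⟧ L] (iM : M →ₗ[A⟦X⟧] N) (iL : (ι → A⟦X⟧) →ₗ[A⟦X⟧] L)
    [IsLocalizedModule (Submonoid.powers (X : A⟦X⟧)) iM]
    [IsLocalizedModule (Submonoid.powers (X : A⟦X⟧)) iL] (e : N ≃ₗ[A⟦X⟧] L) :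
    Module.Free A⟦X⟧ M := by
  let S := Submonoid.powers (X : A⟦X⟧)
  have _ : Module.FinitePresentation A⟦X⟧ M := Module.finitePresentation_of_projective _ _
  obtain ⟨f, ⟨_, i, rfl⟩, hf⟩ := Module.FinitePresentation.exists_lift_of_isLocalizedModule S iL
    (e.toLinearMap.comp iM)
  obtain ⟨g, ⟨_, j, rfl⟩, hg⟩ := Module.FinitePresentation.exists_lift_of_isLocalizedModule S iM
    (e.symm.toLinearMap.comp iL)
  have hf' : ∀ x, iL (f x) = (X : A⟦X⟧) ^ i • e (iM x) := fun x ↦ LinearMap.congr_fun hf x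
  have hg' : ∀ v, iM (g v) = (X : A⟦X⟧) ^ j • e.symm (iL v) := fun v ↦ LinearMap.congr_fun hg v
  refine free_of_comp_eq_X_pow_smul f g (i + j)
    (fun v ↦ injective_of_isLocalizedModule_powers_X iL ?_)
    fun x ↦ injective_of_isLocalizedModule_powers_X iM ?_
  · rw [hf', hg', map_smul, map_smul, LinearEquiv.apply_symm_apply, smul_smul, pow_add]
  · rw [hg', hf', map_smul, map_smul, LinearEquiv.symm_apply_apply, smul_smul, add_comm, pow_add]

end PowerSeriesModule

/-- A finitely generated projective `A⟦t⟧`-module that becomes free over the Laurent series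
ring `A((t))` (the localization of `A⟦t⟧` away from `t`) is free: every vector bundle on
`Spec A⟦t⟧` trivializing over `Spec A((t))` is trivial (the case `G = GL_n` of the
affine Grassmannian being the presheaf quotient `LG/L⁺G`). -/
theorem free_of_free_laurentSeries (A : Type*) [CommRing A]
    (M : Type*) [AddCommGroup M] [Module (PowerSeries A) M]
    [Module.Finite (PowerSeries A) M] [Module.Projective (PowerSeries A) M]
    (h : Module.Free (Localization.Away (PowerSeries.X : PowerSeries A))
      (Localization.Away (PowerSeries.X : PowerSeries A) ⊗[PowerSeries A] M)) :
    Module.Free (PowerSeries A) M := by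
  let R := PowerSeries A
  let Rx := Localization.Away (PowerSeries.X : R)
  let ι := Module.Free.ChooseBasisIndex Rx (Rx ⊗[R] M)
  exact free_of_isLocalizedModule_powers_X (TensorProduct.mk R Rx M 1)
    (.pi fun i : ι ↦ Algebra.linearMap R Rx ∘ₗ .proj i)
    ((Module.Free.chooseBasis Rx (Rx ⊗[R] M)).equivFun.restrictScalars R)
end

section
/- Let A be a commutative ring and let M be a finitely generated projective module over the power series ring A⟦t⟧ such that M ⊗_{A⟦t⟧} A((t)) is a free A((t))-module. Then M becomes free Zariski-locally on A: there exist finitely many elements f₁, …, f_k ∈ A generating the unit ideal of A such that for each i, the base change M ⊗_{A⟦t⟧} (A_{f_i})⟦t⟧ along the coefficientwise map A⟦t⟧ → (A_{f_i})⟦t⟧ is a free (A_{f_i})⟦t⟧-module, where A_{f_i} is the localization of A away from f_i. -/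
set_option synthInstance.maxHeartbeats 1000000

open TensorProduct

namespace Module.Free

/-- A finite projective module is free if its reduction modulo a regular element of the Jacobson
radical is free. -/
theorem of_free_baseChange_of_ker_eq_span {R S : Type*} [CommRing R] [CommRing S] [Algebra R S]
    {x : R} (hx : x ∈ (⊥ : Ideal R).jacobson) (reg : IsRegular x)
    (surj : Function.Surjective (algebraMap R S))
    (ker_eq : RingHom.ker (algebraMap R S) = Ideal.span {x})
    (N : Type*) [AddCommGroup N] [Module R N] [Module.Finite R N] [Module.Projective R N]
    [Module.Free S (S ⊗[R] N)] : Module.Free R N := by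
  have : Module.FinitePresentation R N := Module.finitePresentation_of_projective _ _
  rw [← Module.free_quotSMulTop_iff_free R N hx (Module.IsTorsionFree.isSMulRegular reg)]
  let Q := R ⧸ Ideal.span {x}
  let e : Q ≃ₐ[R] S := (Ideal.quotientEquivAlgOfEq R ker_eq.symm).trans
    (Ideal.quotientKerAlgEquivOfSurjective (f := Algebra.ofId R S) surj)
  let : Algebra S Q := e.symm.toRingEquiv.toRingHom.toAlgebra
  have : IsScalarTower R S Q := .of_algebraMap_eq fun r ↦ (e.symm.commutes r).symm
  have : Module.Free Q (Q ⊗[R] N) :=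
    .of_equiv (AlgebraTensorModule.cancelBaseChange R S Q Q N)
  exact .of_equiv ((QuotSMulTop.equivQuotTensor x N).extendScalarsOfSurjective
    Ideal.Quotient.mk_surjective).symm

/-- In a commutative square of rings `R → R' → B`, `R → A → B` in which `B` is the quotient of `R'`
by a regular element of its Jacobson radical, a finite projective `R`-module whose base change
to `A` becomes free over `B` is already free over `R'`. -/
theorem baseChange_of_comm_square {R A R' B : Type*} [CommRing R] [CommRing A] [CommRing R']
    [CommRing B] [Algebra R A] [Algebra R R'] [Algebra A B] (g : R' →+* B)
    (comm : g.comp (algebraMap R R') = (algebraMap A B).comp (algebraMap R A))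
    {x : R'} (hx : x ∈ (⊥ : Ideal R').jacobson) (reg : IsRegular x)
    (surj : Function.Surjective g) (ker_eq : RingHom.ker g = Ideal.span {x})
    (M : Type*) [AddCommGroup M] [Module R M] [Module.Finite R M] [Module.Projective R M]
    [Module.Free B (B ⊗[A] (A ⊗[R] M))] : Module.Free R' (R' ⊗[R] M) := by
  let : Algebra R' B := g.toAlgebra
  let : Algebra R B := ((algebraMap A B).comp (algebraMap R A)).toAlgebra
  have : IsScalarTower R A B := .of_algebraMap_eq fun _ ↦ rfl
  have : IsScalarTower R R' B := .of_algebraMap_eq fun r ↦ (RingHom.congr_fun comm r).symm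
  have : Module.Free B (B ⊗[R'] (R' ⊗[R] M)) :=
    .of_equiv ((AlgebraTensorModule.cancelBaseChange R A B B M).trans
      (AlgebraTensorModule.cancelBaseChange R R' B B M).symm)
  exact of_free_baseChange_of_ker_eq_span hx reg surj ker_eq _

end Module.Free

/-- A finite projective module is free Zariski-locally. -/
theorem Module.Projective.span_free_localizationAway_eq_top (A : Type*) [CommRing A]
    (P : Type*) [AddCommGroup P] [Module A P] [Module.Finite A P] [Module.Projective A P] :
    Ideal.span {f : A | Module.Free (Localization.Away f) (Localization.Away f ⊗[A] P)} = ⊤ := by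
  by_contra hne
  obtain ⟨m, hm, hle⟩ := Ideal.exists_le_maximal _ hne
  have : Module.FinitePresentation A P := Module.finitePresentation_of_projective _ _
  have : Module.Free (Localization.AtPrime m) (LocalizedModule m.primeCompl P) :=
    Module.free_of_flat_of_isLocalRing
  obtain ⟨r, hr, hfree, -⟩ := Module.FinitePresentation.exists_free_localizedModule_powers
    m.primeCompl (LocalizedModule.mkLinearMap m.primeCompl P) (Localization.AtPrime m)
  refine hr (hle (Ideal.subset_span ?_))
  exact .of_equiv (LocalizedModule.equivTensorProduct (.powers r) P)

namespace PowerSeries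

theorem X_mem_jacobson_bot_s15 (R : Type*) [CommRing R] :
    (X : PowerSeries R) ∈ (⊥ : Ideal (PowerSeries R)).jacobson := by
  rw [Ideal.mem_jacobson_bot]
  intro y
  simp [isUnit_iff_constantCoeff]

theorem ker_constantCoeff_eq_span_X (R : Type*) [CommRing R] :
    RingHom.ker (constantCoeff (R := R)) = Ideal.span {X} := by
  ext φ
  rw [RingHom.mem_ker, Ideal.mem_span_singleton, X_dvd_iff]

/-- A finite projective `A⟦X⟧`-module becomes free over `(A_f)⟦X⟧` for enough `f` to generate
the unit ideal of `A`. -/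
theorem span_free_baseChange_localizationAway_eq_top (A : Type*) [CommRing A]
    (M : Type*) [AddCommGroup M] [Module (PowerSeries A) M]
    [Module.Finite (PowerSeries A) M] [Module.Projective (PowerSeries A) M] :
    Ideal.span {f : A | Module.Free (PowerSeries (Localization.Away f))
      (PowerSeries (Localization.Away f) ⊗[PowerSeries A] M)} = ⊤ := by
  let : Algebra (PowerSeries A) A := (constantCoeff (R := A)).toAlgebra
  refine top_le_iff.mp ((Module.Projective.span_free_localizationAway_eq_top A
    (A ⊗[PowerSeries A] M)).ge.trans (Ideal.span_mono fun f hf ↦ ?_))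
  have : Module.Free _ _ := hf
  refine Module.Free.baseChange_of_comm_square (A := A) (constantCoeff (R := Localization.Away f))
    (RingHom.ext fun φ ↦ ?_) (X_mem_jacobson_bot_s15 _)
    ⟨X_mul_injective, mul_X_injective⟩
    constantCoeff_surj (ker_constantCoeff_eq_span_X _) M
  change constantCoeff (map (algebraMap A _) φ) = algebraMap A _ (constantCoeff φ)
  simp only [← coeff_zero_eq_constantCoeff_apply, coeff_map]

end PowerSeries

/-- A finitely generated projective `A⟦t⟧`-module that becomes free over the Laurent
series ring `A((t))` becomes free Zariski-locally on `A`: there are `f₁, …, f_k ∈ A`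
generating the unit ideal such that each base change along the coefficientwise map
`A⟦t⟧ → (A_{fᵢ})⟦t⟧` is free (the case `G = GL_n` of `Gr_G = (LG/L⁺G)_Zar`). -/
theorem free_zariski_locally_of_free_laurentSeries (A : Type*) [CommRing A]
    (M : Type*) [AddCommGroup M] [Module (PowerSeries A) M]
    [Module.Finite (PowerSeries A) M] [Module.Projective (PowerSeries A) M]
    (h : Module.Free (Localization.Away (PowerSeries.X : PowerSeries A))
      (Localization.Away (PowerSeries.X : PowerSeries A) ⊗[PowerSeries A] M)) :
    ∃ (k : ℕ) (f : Fin k → A), Ideal.span (Set.range f) = ⊤ ∧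
      ∀ i : Fin k,
        Module.Free (PowerSeries (Localization.Away (f i)))
          (PowerSeries (Localization.Away (f i)) ⊗[PowerSeries A] M) := by
  obtain ⟨s, hs, hspan⟩ := (Ideal.span_eq_top_iff_finite _).mp
    (PowerSeries.span_free_baseChange_localizationAway_eq_top A M)
  refine ⟨s.card, fun i ↦ s.equivFin.symm i, ?_, fun i ↦ hs (s.equivFin.symm i).2⟩
  rw [← hspan, ← Function.comp_def, s.equivFin.symm.surjective.range_comp, Subtype.range_coe]
end
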